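/- arXiv:2403.20217 — 13 statements merged into one kernel-verified Lean document; each statement's English description precedes it below -/
import Mathlib

section
/- For all real numbers ħ > 0, ω > 0, g > 0 and E ≥ 0, letting a_± = √((E + 2ħωg ± √(E(E + 4ħωg)))/(2ω²)) (so 0 < a_- ≤ a_+ are the positive roots of E − (ωx − ħg/x)² = 0), one has ∫_{a_-}^{a_+} √(E − (ωx − ħg/x)²) dx = πE/(4ω). -/
open Real MeasureTheory

/-- The SWKB integral of the radial oscillator (superpotential `W x = ω x - ℏ g / x`
on the half line `x > 0`) at energy `E ≥ 0`, between the two positive turning points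
`a₋ ≤ a₊`, evaluates in closed form to `π E / (4 ω)`. -/
theorem swkb_integral_radial_oscillator (ℏ ω g E : ℝ)
    (hℏ : 0 < ℏ) (hω : 0 < ω) (hg : 0 < g) (hE : 0 ≤ E) :
    ∫ x in
      (Real.sqrt ((E + 2 * ℏ * ω * g - Real.sqrt (E * (E + 4 * ℏ * ω * g))) / (2 * ω ^ 2)))..
      (Real.sqrt ((E + 2 * ℏ * ω * g + Real.sqrt (E * (E + 4 * ℏ * ω * g))) / (2 * ω ^ 2))),
      Real.sqrt (E - (ω * x - ℏ * g / x) ^ 2) = Real.pi * E / (4 * ω) := by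
  obtain ⟨s, hs, rfl⟩ : ∃ s : ℝ, 0 ≤ s ∧ s ^ 2 = E := ⟨√E, Real.sqrt_nonneg _, Real.sq_sqrt hE⟩
  have hc : 0 < 4 * ℏ * ω * g := by positivity
  set R : ℝ → ℝ := fun t => √((s * t) ^ 2 + 4 * ℏ * ω * g) with hR
  have hpos : ∀ t, 0 < (s * t) ^ 2 + 4 * ℏ * ω * g := fun t => by positivity
  have hRpos : ∀ t, 0 < R t := fun t => Real.sqrt_pos.2 (hpos t)
  have hRsq : ∀ t, R t ^ 2 = (s * t) ^ 2 + 4 * ℏ * ω * g := fun t => Real.sq_sqrt (hpos t).le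
  have hRneg : ∀ t, R (-t) = R t := fun t => by simp [hR]
  have hRcont : Continuous R := by simp only [hR]; fun_prop
  set φ : ℝ → ℝ := fun t => (s * t + R t) / (2 * ω) with hφ
  set φ' : ℝ → ℝ := fun t => (s + s ^ 2 * t / R t) / (2 * ω) with hφ'
  have hφpos : ∀ t, 0 < φ t := by
    intro t
    have : -(s * t) < R t := by
      apply lt_of_pow_lt_pow_left₀ 2 (hRpos t).le
      rw [hRsq]; nlinarith
    simp only [hφ]
    apply div_pos <;> linarith
  have hder : ∀ t, HasDerivAt φ (φ' t) t := by
    intro t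
    have h1 : HasDerivAt (fun t : ℝ => s * t) s t := by
      simpa using (hasDerivAt_id t).const_mul s
    have h2 := ((h1.pow 2).add_const (4 * ℏ * ω * g)).sqrt (hpos t).ne'
    have h3 := (h1.add h2).div_const (2 * ω)
    refine h3.congr_deriv ?_
    have := (hRpos t).ne'
    simp only [hφ']
    change (s + _ / (2 * R t)) / _ = _
    field_simp
    simp
    try ring
  have hφ'c : Continuous φ' := by
    simp only [hφ']
    refine Continuous.div_const (continuous_const.add (Continuous.div (by fun_prop) hRcont (fun t => (hRpos t).ne'))) _
  have hW : ∀ t, ω * φ t - ℏ * g / φ t = s * t := by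
    intro t
    have h0 := (hφpos t).ne'
    have h1 : ω * φ t ^ 2 - ℏ * g = s * t * φ t := by
      have := hRsq t
      simp only [hφ]
      field_simp
      linear_combination this
    field_simp
    linear_combination h1
  have hsq1 : √(s ^ 2 * (s ^ 2 + 4 * ℏ * ω * g)) = s * R 1 := by
    rw [Real.sqrt_mul (by positivity), Real.sqrt_sq hs]; simp [hR]
  have hR1 := hRsq 1
  have ha : √((s ^ 2 + 2 * ℏ * ω * g - √(s ^ 2 * (s ^ 2 + 4 * ℏ * ω * g))) / (2 * ω ^ 2))
      = φ (-1) := by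
    rw [hsq1, Real.sqrt_eq_iff_mul_self_eq_of_pos (hφpos _)]
    simp only [hφ, hRneg]
    field_simp
    linear_combination hR1
  have hb : √((s ^ 2 + 2 * ℏ * ω * g + √(s ^ 2 * (s ^ 2 + 4 * ℏ * ω * g))) / (2 * ω ^ 2))
      = φ 1 := by
    rw [hsq1, Real.sqrt_eq_iff_mul_self_eq_of_pos (hφpos _)]
    simp only [hφ]
    field_simp
    linear_combination hR1
  rw [ha, hb, ← intervalIntegral.integral_comp_mul_deriv' (fun t _ => hder t) hφ'c.continuousOn]
  · have key : ∀ t, ((fun x => √(s ^ 2 - (ω * x - ℏ * g / x) ^ 2)) ∘ φ) t * φ' t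
        = s ^ 2 / (2 * ω) * √(1 - t ^ 2) + s ^ 3 / (2 * ω) * (√(1 - t ^ 2) * (t / R t)) := by
      intro t
      simp only [Function.comp, hW, hφ']
      rw [show s ^ 2 - (s * t) ^ 2 = s ^ 2 * (1 - t ^ 2) by ring,
        Real.sqrt_mul (by positivity), Real.sqrt_sq hs]
      ring
    have hoc : Continuous fun t => √(1 - t ^ 2) * (t / R t) :=
      Continuous.mul (by fun_prop) (continuous_id.div hRcont (fun t => (hRpos t).ne'))
    have hodd : ∫ t in (-1:ℝ)..1, √(1 - t ^ 2) * (t / R t) = 0 := by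
      have h := intervalIntegral.integral_comp_neg (a := -1) (b := 1)
        (fun t => √(1 - t ^ 2) * (t / R t))
      simp only [hRneg, neg_sq, neg_div, mul_neg, neg_neg, intervalIntegral.integral_neg] at h
      linarith
    simp only [key]
    rw [intervalIntegral.integral_add, intervalIntegral.integral_const_mul,
      intervalIntegral.integral_const_mul, hodd, integral_sqrt_one_sub_sq]
    · ring
    · exact Continuous.intervalIntegrable (by fun_prop) _ _
    · exact (hoc.const_mul _).intervalIntegrable _ _
  · rintro x ⟨t, _, rfl⟩
    have := (hφpos t).ne'
    apply ContinuousAt.continuousWithinAt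
    fun_prop (disch := assumption)
end

section
/- For all real numbers ħ > 0, g > 0, h > 0 and E ≥ 0, let t_± = (E + 2ħ²gh ± √(E(E + 4ħ²gh)))/(2ħ²h²) (the two roots of ħ²h²t² − (E + 2ħ²gh)t + ħ²g² = 0) and set a_± = arctan(√(t_±)) ∈ (0, π/2). Then ∫_{a_-}^{a_+} √(E − ħ²(g·cot x − h·tan x)²) dx = (π/2)·(√(E + ħ²(g+h)²) − ħ(g+h)). -/
open Real MeasureTheory

lemma swkb_aux0 (a b : ℝ) (ha : 0 < a) (hab : a < b) :
    ∫ z in a..b, √((z - a) * (b - z)) / z = π / 2 * (a + b) - π * √(a * b) := by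
  have hb : 0 < b := ha.trans hab
  have hd : 0 < b - a := sub_pos.2 hab
  set s := √(a * b) with hs
  have hs0 : 0 < s := Real.sqrt_pos.2 (mul_pos ha hb)
  have hs2 : s ^ 2 = a * b := Real.sq_sqrt (mul_pos ha hb).le
  have key := intervalIntegral.integral_eq_sub_of_hasDerivAt_of_le (a := a) (b := b)
    (f := fun z => √((z - a) * (b - z)) + (a + b) / 2 * arcsin ((2 * z - a - b) / (b - a))
      - s * arcsin (((a + b) * z - 2 * (a * b)) / (z * (b - a))))
    (f' := fun z => √((z - a) * (b - z)) / z) hab.le ?_ ?_ ?_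
  · rw [key]
    have e1 : (2 * b - a - b) / (b - a) = 1 := by field_simp; ring
    have e2 : (2 * a - a - b) / (b - a) = -1 := by field_simp; ring
    have e3 : ((a + b) * b - 2 * (a * b)) / (b * (b - a)) = 1 := by field_simp; ring
    have e4 : ((a + b) * a - 2 * (a * b)) / (a * (b - a)) = -1 := by field_simp; ring
    simp only [e1, e2, e3, e4, sub_self, zero_mul, mul_zero, Real.sqrt_zero, arcsin_one,
      arcsin_neg]
    ring
  · have hz : ∀ z ∈ Set.Icc a b, z * (b - a) ≠ 0 := fun z hz =>
      (mul_pos (ha.trans_le hz.1) hd).ne'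
    refine ContinuousOn.sub (Continuous.continuousOn (by fun_prop)) ?_
    refine continuousOn_const.mul (continuous_arcsin.comp_continuousOn ?_)
    exact ContinuousOn.div (by fun_prop) (by fun_prop) hz
  · intro z hz
    have h1 : 0 < z - a := sub_pos.2 hz.1
    have h2 : 0 < b - z := sub_pos.2 hz.2
    have hz0 : 0 < z := ha.trans hz.1
    have hq : 0 < (z - a) * (b - z) := mul_pos h1 h2
    set r := √((z - a) * (b - z)) with hr
    have hr0 : 0 < r := Real.sqrt_pos.2 hq
    have hr2 : r ^ 2 = (z - a) * (b - z) := Real.sq_sqrt hq.le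
    have s1 : 1 - ((2 * z - a - b) / (b - a)) ^ 2 = (2 * r / (b - a)) ^ 2 := by
      rw [div_pow, div_pow, mul_pow, hr2]; field_simp; ring
    have s2 : 1 - (((a + b) * z - 2 * (a * b)) / (z * (b - a))) ^ 2
        = (2 * s * r / (z * (b - a))) ^ 2 := by
      rw [div_pow, div_pow, mul_pow (2 * s) r, mul_pow 2 s, hr2, hs2]; field_simp; ring
    have p1 : 0 < 2 * r / (b - a) := by positivity
    have p2 : 0 < 2 * s * r / (z * (b - a)) := by positivity
    have n1 : ∀ p q : ℝ, 0 < q → 1 - p ^ 2 = q ^ 2 → HasDerivAt arcsin (1 / q) p := by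
      intro p q hq h
      have := Real.hasDerivAt_arcsin (x := p) (by rintro rfl; nlinarith)
        (by rintro rfl; nlinarith)
      rwa [h, Real.sqrt_sq hq.le] at this
    have d1 : HasDerivAt (fun z => √((z - a) * (b - z)))
        ((1 * (b - z) + (z - a) * (-1)) / (2 * r)) z :=
      (((hasDerivAt_id z).sub_const a).mul ((hasDerivAt_id z).const_sub b)).sqrt hq.ne'
    have d2 : HasDerivAt (fun z => (2 * z - a - b) / (b - a)) (2 * 1 / (b - a)) z :=
      ((((hasDerivAt_id z).const_mul 2).sub_const a).sub_const b).div_const _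
    have d3 : HasDerivAt (fun z => ((a + b) * z - 2 * (a * b)) / (z * (b - a)))
        ((((a + b) * 1) * (z * (b - a)) - ((a + b) * z - 2 * (a * b)) * (1 * (b - a)))
          / (z * (b - a)) ^ 2) z :=
      ((((hasDerivAt_id z).const_mul (a + b)).sub_const _).div
        ((hasDerivAt_id z).mul_const (b - a)) (by positivity))
    have := (d1.add (((n1 _ _ p1 s1).comp z d2).const_mul ((a + b) / 2))).sub
      (((n1 _ _ p2 s2).comp z d3).const_mul s)
    refine this.congr_deriv ?_
    have : r / z = (z - a) * (b - z) / (r * z) := by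
      rw [← hr2]; field_simp
    rw [this]
    field_simp
    ring
  · apply ContinuousOn.intervalIntegrable
    rw [Set.uIcc_of_le hab.le]
    exact ContinuousOn.div (Continuous.continuousOn (by fun_prop)) continuousOn_id
      fun z hz => (ha.trans_le hz.1).ne'

lemma swkb_aux1 (a b : ℝ) (ha : 0 < a) (hab : a < b) :
    ∫ z in a..b, √((z - a) * (b - z)) / (z * (1 + z))
      = π * (√((1 + a) * (1 + b)) - √(a * b) - 1) := by
  have h0 := swkb_aux0 a b ha hab
  have h1 := swkb_aux0 (a + 1) (b + 1) (by linarith) (by linarith)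
  rw [← intervalIntegral.integral_comp_add_right] at h1
  have hc : ∀ c : ℝ, 0 ≤ c → IntervalIntegrable
      (fun z => √((z - a) * (b - z)) / (z + c)) volume a b := by
    intro c hc
    apply ContinuousOn.intervalIntegrable
    rw [Set.uIcc_of_le hab.le]
    exact ContinuousOn.div (Continuous.continuousOn (by fun_prop)) (by fun_prop)
      fun z hz => by have := hz.1; linarith
  have i0 := hc 0 le_rfl
  have i1 := hc 1 zero_le_one
  simp only [add_zero] at i0
  have e : ∀ z : ℝ, (z + 1 - (a + 1)) * (b + 1 - (z + 1)) = (z - a) * (b - z) := by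
    intro z; ring
  simp only [e] at h1
  have : ∫ z in a..b, √((z - a) * (b - z)) / (z * (1 + z))
      = ∫ z in a..b, (√((z - a) * (b - z)) / z - √((z - a) * (b - z)) / (z + 1)) := by
    apply intervalIntegral.integral_congr
    rw [Set.uIcc_of_le hab.le]
    intro z hz
    have hz0 : 0 < z := ha.trans_le hz.1
    have : 0 < 1 + z := by linarith
    have : 0 < z + 1 := by linarith
    simp only
    field_simp
    ring
  rw [this, intervalIntegral.integral_sub i0 i1, h0, h1, add_comm a 1, add_comm b 1]
  ring

lemma swkb_aux2 (G H E a b : ℝ) (hH : 0 < H) (ha : 0 < a) (hab : a < b)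
    (hQ : ∀ t, E * t - (G - H * t) ^ 2 = H ^ 2 * ((t - a) * (b - t))) :
    ∫ x in (arctan √a)..(arctan √b), √(E - (G * cot x - H * tan x) ^ 2)
      = H / 2 * (π * (√((1 + a) * (1 + b)) - √(a * b) - 1)) := by
  have hcot : ∀ x, cot x = (tan x)⁻¹ := fun x => by
    rw [Real.cot_eq_cos_div_sin, Real.tan_eq_sin_div_cos, inv_div]
  have hpos : ∀ t ∈ Set.uIcc a b, 0 < t := by
    rw [Set.uIcc_of_le hab.le]; exact fun t ht => ha.trans_le ht.1
  rw [← swkb_aux1 a b ha hab, ← intervalIntegral.integral_const_mul]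
  have key := intervalIntegral.integral_comp_mul_deriv' (a := a) (b := b)
    (f := fun t => arctan √t) (f' := fun t => 1 / (1 + (√t) ^ 2) * (1 / (2 * √t)))
    (g := fun x => √(E - (G * cot x - H * tan x) ^ 2)) ?_ ?_ ?_
  · rw [← key]
    apply intervalIntegral.integral_congr
    intro t ht
    have ht0 := hpos t ht
    set u := √t with hu
    have hu0 : 0 < u := Real.sqrt_pos.2 ht0
    have hu2 : u ^ 2 = t := Real.sq_sqrt ht0.le
    have e : E - (G * u⁻¹ - H * u) ^ 2 = H ^ 2 * ((t - a) * (b - t)) / u ^ 2 := by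
      rw [← hQ, ← hu2]; field_simp
    simp only [Function.comp, hcot, tan_arctan, ← hu]
    rw [e, Real.sqrt_div' _ (by positivity), Real.sqrt_sq hu0.le,
      Real.sqrt_mul (by positivity), Real.sqrt_sq hH.le]
    generalize √((t - a) * (b - t)) = r
    rw [← hu2]
    field_simp
  · intro t ht
    have := hpos t ht
    exact (Real.hasDerivAt_arctan _).comp t (Real.hasDerivAt_sqrt this.ne')
  · refine ContinuousOn.mul ?_ ?_
    · exact ContinuousOn.div (by fun_prop) (by fun_prop) fun t _ => by positivity
    · exact ContinuousOn.div (by fun_prop) (by fun_prop) fun t ht => by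
        have := hpos t ht
        positivity
  · rintro _ ⟨t, ht, rfl⟩
    apply ContinuousAt.continuousWithinAt
    have := Real.sqrt_pos.2 (hpos t ht)
    have ct : ContinuousAt tan (arctan √t) :=
      Real.continuousAt_tan.2 (Real.cos_arctan_pos _).ne'
    have ci : ContinuousAt (fun x => (tan x)⁻¹) (arctan √t) :=
      ct.inv₀ (by rw [tan_arctan]; exact this.ne')
    simp only [hcot]
    exact (continuousAt_const.sub (((continuousAt_const.mul ci).sub
      (continuousAt_const.mul ct)).pow 2)).sqrt

/-- The SWKB integral of the Pöschl–Teller potential (superpotential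
`W x = -ℏ (g cot x - h tan x)` on `(0, π/2)`) at energy `E ≥ 0`, between the two
turning points `a₋ = arctan √t₋` and `a₊ = arctan √t₊`, evaluates in closed form to
`(π/2) (√(E + ℏ²(g+h)²) - ℏ(g+h))`. -/
theorem swkb_integral_poschl_teller (ℏ g h E : ℝ)
    (hℏ : 0 < ℏ) (hg : 0 < g) (hh : 0 < h) (hE : 0 ≤ E) :
    ∫ x in
      (Real.arctan (Real.sqrt
        ((E + 2 * ℏ ^ 2 * g * h - Real.sqrt (E * (E + 4 * ℏ ^ 2 * g * h))) / (2 * ℏ ^ 2 * h ^ 2))))..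
      (Real.arctan (Real.sqrt
        ((E + 2 * ℏ ^ 2 * g * h + Real.sqrt (E * (E + 4 * ℏ ^ 2 * g * h))) / (2 * ℏ ^ 2 * h ^ 2)))),
      Real.sqrt (E - ℏ ^ 2 * (g * Real.cot x - h * Real.tan x) ^ 2)
      = Real.pi / 2 * (Real.sqrt (E + ℏ ^ 2 * (g + h) ^ 2) - ℏ * (g + h)) := by
  rcases hE.eq_or_lt with rfl | hE
  · have : √(0 + ℏ ^ 2 * (g + h) ^ 2) = ℏ * (g + h) := by
      rw [zero_add, ← mul_pow, Real.sqrt_sq (by positivity)]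
    rw [this]
    simp
  have hgh : 0 < ℏ ^ 2 * g * h := by positivity
  have hD : 0 < E * (E + 4 * ℏ ^ 2 * g * h) := by positivity
  set D := √(E * (E + 4 * ℏ ^ 2 * g * h)) with hDdef
  have hD0 : 0 < D := Real.sqrt_pos.2 hD
  have hD2 : D ^ 2 = E * (E + 4 * ℏ ^ 2 * g * h) := Real.sq_sqrt hD.le
  have hDlt : D < E + 2 * ℏ ^ 2 * g * h := by
    apply lt_of_pow_lt_pow_left₀ 2 (by positivity)
    rw [hD2]; nlinarith [mul_pos hgh hgh]
  set a := (E + 2 * ℏ ^ 2 * g * h - D) / (2 * ℏ ^ 2 * h ^ 2) with hadef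
  set b := (E + 2 * ℏ ^ 2 * g * h + D) / (2 * ℏ ^ 2 * h ^ 2) with hbdef
  have hden : 0 < 2 * ℏ ^ 2 * h ^ 2 := by positivity
  have ha : 0 < a := div_pos (by linarith) hden
  have hab : a < b := by
    rw [hadef, hbdef]; gcongr; linarith
  have hsum : a + b = (E + 2 * ℏ ^ 2 * g * h) / (ℏ ^ 2 * h ^ 2) := by
    rw [hadef, hbdef]; field_simp; ring
  have hprod : a * b = (g / h) ^ 2 := by
    have : a * b = ((E + 2 * ℏ ^ 2 * g * h) ^ 2 - D ^ 2) / (2 * ℏ ^ 2 * h ^ 2) ^ 2 := by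
      rw [hadef, hbdef]; field_simp; ring
    rw [this, hD2]; field_simp; ring
  have hprod1 : (1 + a) * (1 + b) = (E + ℏ ^ 2 * (g + h) ^ 2) / (ℏ * h) ^ 2 := by
    have : (1 + a) * (1 + b) = 1 + (a + b) + a * b := by ring
    rw [this, hsum, hprod]; field_simp; ring
  have hQ : ∀ t, E * t - (ℏ * g - ℏ * h * t) ^ 2 = (ℏ * h) ^ 2 * ((t - a) * (b - t)) := by
    intro t
    have : (t - a) * (b - t) = (a + b) * t - t ^ 2 - a * b := by ring
    rw [this, hsum, hprod]; field_simp; ring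
  have key := swkb_aux2 (ℏ * g) (ℏ * h) E a b (by positivity) ha hab hQ
  have e : ∀ x, ℏ ^ 2 * (g * cot x - h * tan x) ^ 2 = (ℏ * g * cot x - ℏ * h * tan x) ^ 2 := by
    intro x; ring
  simp only [e]
  rw [key, hprod, hprod1, Real.sqrt_sq (by positivity), Real.sqrt_div' _ (by positivity),
    Real.sqrt_sq (by positivity)]
  field_simp
  ring
end

section
/- For all real numbers ħ > 0, g > 0 and E > 0, let a ∈ (0, π/2) be the unique angle with cot a = √E/(ħg). Then ∫_{a}^{π−a} √(E − ħ²g²·cot²x) dx = π·(√(E + ħ²g²) − ħg). In particular, for E = ħ²n(n + 2g) with n a natural number, the integral equals nπħ. -/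
open Real MeasureTheory

theorem swkb_aux (k E a : ℝ) (hk : 0 < k) (hE : 0 < E)
    (ha : a ∈ Set.Ioo 0 (Real.pi / 2))
    (hcot : Real.cot a = Real.sqrt E / k) :
    (∫ x in a..(Real.pi - a), Real.sqrt (E - k ^ 2 * Real.cot x ^ 2))
      = Real.pi * (Real.sqrt (E + k ^ 2) - k) := by
  obtain ⟨ha0, ha1⟩ := ha
  have hpi := Real.pi_pos
  have hsa : 0 < Real.sin a := Real.sin_pos_of_pos_of_lt_pi ha0 (by linarith)
  have hca : 0 < Real.cos a := Real.cos_pos_of_mem_Ioo ⟨by linarith, ha1⟩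
  have hsc := Real.sin_sq_add_cos_sq a
  have hs : Real.sqrt E = k * (Real.cos a / Real.sin a) := by
    rw [← Real.cot_eq_cos_div_sin, hcot]; field_simp
  have hEE : E = (k * (Real.cos a / Real.sin a)) ^ 2 := by
    rw [← hs, Real.sq_sqrt hE.le]
  have hC : Real.sqrt (E + k ^ 2) = k / Real.sin a := by
    rw [Real.sqrt_eq_iff_mul_self_eq (by positivity) (by positivity), hEE]
    field_simp
    linarith
  have hsin : ∀ x ∈ Set.Icc a (Real.pi - a), 0 < Real.sin x := fun x hx =>
    Real.sin_pos_of_pos_of_lt_pi (by linarith [hx.1]) (by linarith [hx.2])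
  have hle : a ≤ Real.pi - a := by linarith
  have hcontcot : ContinuousOn (fun x => Real.cos x / Real.sin x) (Set.Icc a (Real.pi - a)) :=
    Real.continuous_cos.continuousOn.div Real.continuous_sin.continuousOn
      fun x hx => (hsin x hx).ne'
  simp only [Real.cot_eq_cos_div_sin]
  have key := intervalIntegral.integral_eq_sub_of_hasDerivAt_of_le hle
    (f := fun x => -(k / Real.sin a) * Real.arcsin (Real.cos x / Real.cos a)
      + k * Real.arcsin ((Real.cos x / Real.sin x) / (Real.cos a / Real.sin a)))
    (f' := fun x => Real.sqrt (E - k ^ 2 * (Real.cos x / Real.sin x) ^ 2)) ?_ ?_ ?_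
  · rw [key, hC]
    simp only [Real.cos_pi_sub, Real.sin_pi_sub, neg_div]
    rw [div_self hca.ne', div_self (by positivity)]
    simp only [Real.arcsin_neg, Real.arcsin_one]
    ring
  · refine ContinuousOn.add (ContinuousOn.mul continuousOn_const ?_)
      (ContinuousOn.mul continuousOn_const ?_)
    · exact (Real.continuous_arcsin.comp (Real.continuous_cos.div_const _)).continuousOn
    · exact Real.continuous_arcsin.comp_continuousOn (hcontcot.div_const _)
  · intro x hx
    have hsx := hsin x ⟨hx.1.le, hx.2.le⟩
    have h1 : Real.cos x < Real.cos a :=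
      Real.cos_lt_cos_of_nonneg_of_le_pi ha0.le (by linarith [hx.2]) hx.1
    have h2 : -Real.cos a < Real.cos x := by
      rw [← Real.cos_pi_sub]
      exact Real.cos_lt_cos_of_nonneg_of_le_pi (by linarith [hx.1]) (by linarith) hx.2
    have h3 : 0 < Real.cos a ^ 2 - Real.cos x ^ 2 := by nlinarith
    have hscx := Real.sin_sq_add_cos_sq x
    set D := Real.sqrt (Real.cos a ^ 2 - Real.cos x ^ 2) with hD
    have hDpos : 0 < D := Real.sqrt_pos.2 h3
    have hDsq : D ^ 2 = Real.cos a ^ 2 - Real.cos x ^ 2 := Real.sq_sqrt h3.le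
    have hR : Real.sqrt (E - k ^ 2 * (Real.cos x / Real.sin x) ^ 2)
        = k * D / (Real.sin a * Real.sin x) := by
      rw [← Real.sqrt_sq (show 0 ≤ k * D / (Real.sin a * Real.sin x) by positivity)]
      congr 1
      rw [hEE, div_pow (k * D), mul_pow k D, hDsq]
      field_simp
      rw [Real.sin_sq x, Real.sin_sq a]; ring
    have hu : Real.sqrt (1 - (Real.cos x / Real.cos a) ^ 2) = D / Real.cos a := by
      rw [← Real.sqrt_sq (show 0 ≤ D / Real.cos a by positivity)]
      congr 1
      rw [div_pow D, hDsq]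
      field_simp
    have hw : Real.sqrt (1 - ((Real.cos x / Real.sin x) / (Real.cos a / Real.sin a)) ^ 2)
        = D / (Real.cos a * Real.sin x) := by
      rw [← Real.sqrt_sq (show 0 ≤ D / (Real.cos a * Real.sin x) by positivity)]
      congr 1
      rw [div_pow D, hDsq]
      field_simp
      rw [Real.sin_sq x, Real.sin_sq a]; ring
    have hu0 : 0 < Real.sqrt (1 - (Real.cos x / Real.cos a) ^ 2) := by rw [hu]; positivity
    have hw0 : 0 < Real.sqrt (1 - ((Real.cos x / Real.sin x) / (Real.cos a / Real.sin a)) ^ 2) := by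
      rw [hw]; positivity
    have hne : ∀ y : ℝ, 0 < Real.sqrt (1 - y ^ 2) → y ≠ -1 ∧ y ≠ 1 := by
      intro y hy
      constructor <;> rintro rfl <;> norm_num at hy
    have d1 := (Real.hasDerivAt_arcsin (hne _ hu0).1 (hne _ hu0).2).comp x
      ((Real.hasDerivAt_cos x).div_const (Real.cos a))
    have d2 := (Real.hasDerivAt_arcsin (hne _ hw0).1 (hne _ hw0).2).comp x
      (((Real.hasDerivAt_cos x).div (Real.hasDerivAt_sin x) hsx.ne').div_const
        (Real.cos a / Real.sin a))
    have d := (d1.const_mul (-(k / Real.sin a))).add (d2.const_mul k)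
    refine d.congr_deriv ?_
    rw [hu, hw, hR]
    field_simp
    rw [hDsq]
    have e1 : Real.sin x ^ 2 = 1 - Real.cos x ^ 2 := Real.sin_sq x
    have e2 : Real.sin a ^ 2 = 1 - Real.cos a ^ 2 := Real.sin_sq a
    nlinarith
  · apply ContinuousOn.intervalIntegrable_of_Icc hle
    exact (continuousOn_const.sub (continuousOn_const.mul (hcontcot.pow 2))).sqrt

/-- The SWKB integral of the `1/sin²`-potential (superpotential `W x = -ℏ g cot x`
on `(0, π)`) at energy `E > 0`: with `a ∈ (0, π/2)` the unique angle such that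
`cot a = √E / (ℏ g)`, the integral from `a` to `π - a` equals
`π (√(E + ℏ²g²) - ℏ g)`; in particular, for the bound-state energies
`E = ℏ² n (n + 2g)` it equals `n π ℏ`. -/
theorem swkb_integral_one_over_sin_sq (ℏ g E a : ℝ)
    (hℏ : 0 < ℏ) (hg : 0 < g) (hE : 0 < E)
    (ha : a ∈ Set.Ioo 0 (Real.pi / 2))
    (hcot : Real.cot a = Real.sqrt E / (ℏ * g)) :
    (∫ x in a..(Real.pi - a), Real.sqrt (E - ℏ ^ 2 * g ^ 2 * Real.cot x ^ 2))
      = Real.pi * (Real.sqrt (E + ℏ ^ 2 * g ^ 2) - ℏ * g) ∧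
    ∀ n : ℕ, E = ℏ ^ 2 * n * (n + 2 * g) →
      (∫ x in a..(Real.pi - a), Real.sqrt (E - ℏ ^ 2 * g ^ 2 * Real.cot x ^ 2))
        = n * Real.pi * ℏ := by
  have main := swkb_aux (ℏ * g) E a (by positivity) hE ha hcot
  simp only [mul_pow] at main
  refine ⟨main, fun n hn => ?_⟩
  rw [main]
  have : Real.sqrt (E + ℏ ^ 2 * g ^ 2) = ℏ * (n + g) := by
    rw [← Real.sqrt_sq (show 0 ≤ ℏ * ((n : ℝ) + g) by positivity), hn]
    congr 1
    ring
  rw [this]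
  ring
end

section
/- For all real numbers ħ > 0, μ > 0, h > 0 and E with 0 < E < ħ²h², let x_- = log((h − √E/ħ)/μ) and x_+ = log((h + √E/ħ)/μ) (the two roots of ħ²(μe^x − h)² = E). Then ∫_{x_-}^{x_+} √(E − ħ²(μe^x − h)²) dx = π·(ħh − √(ħ²h² − E)). In particular, for E = ħ²n(2h − n) with n a natural number, n ≤ h, the integral equals nπħ. -/
open Real MeasureTheory

theorem swkb_deriv (s A C w : ℝ) (hs : 0 < s) (hC : 0 < C) (hCs : C ^ 2 = A ^ 2 - s ^ 2)
    (hwA : 0 < w + A) (h1 : -s < w) (h2 : w < s) :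
    HasDerivAt (fun w => √(s ^ 2 - w ^ 2) + A * arcsin (w / s)
      - C * arcsin ((s ^ 2 + A * w) / (s * (w + A)))) (√(s ^ 2 - w ^ 2) / (w + A)) w := by
  have hpos : 0 < s ^ 2 - w ^ 2 := by nlinarith
  have hR : 0 < √(s ^ 2 - w ^ 2) := Real.sqrt_pos.2 hpos
  have hR2 : √(s ^ 2 - w ^ 2) ^ 2 = s ^ 2 - w ^ 2 := Real.sq_sqrt hpos.le
  have d1 : HasDerivAt (fun w => s ^ 2 - w ^ 2) (-(2 * w)) w := by
    simpa using ((hasDerivAt_id w).pow 2).const_sub (s ^ 2)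
  have d2 := d1.sqrt hpos.ne'
  have e1 : √(1 - (w / s) ^ 2) = √(s ^ 2 - w ^ 2) / s := by
    rw [Real.sqrt_eq_iff_mul_self_eq_of_pos (by positivity)]
    rw [div_mul_div_comm, ← sq, hR2]; field_simp
  have e2 : √(1 - ((s ^ 2 + A * w) / (s * (w + A))) ^ 2)
      = C * √(s ^ 2 - w ^ 2) / (s * (w + A)) := by
    rw [Real.sqrt_eq_iff_mul_self_eq_of_pos (by positivity)]
    rw [div_mul_div_comm, ← sq, mul_pow, hR2, hCs]; field_simp; ring
  have n1 : 0 < √(1 - (w / s) ^ 2) := by rw [e1]; positivity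
  have n2 : 0 < √(1 - ((s ^ 2 + A * w) / (s * (w + A))) ^ 2) := by rw [e2]; positivity
  have aux : ∀ z : ℝ, 0 < √(1 - z ^ 2) → z ≠ -1 ∧ z ≠ 1 := by
    intro z hz
    constructor <;> rintro rfl <;> norm_num at hz
  have d3 : HasDerivAt (fun w => w / s) (1 / s) w := (hasDerivAt_id w).div_const s
  have d4 : HasDerivAt (fun w => (s ^ 2 + A * w) / (s * (w + A)))
      ((A * (s * (w + A)) - (s ^ 2 + A * w) * s) / (s * (w + A)) ^ 2) w := by
    have a1 : HasDerivAt (fun w => s ^ 2 + A * w) A w := by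
      simpa using ((hasDerivAt_id w).const_mul A).const_add (s ^ 2)
    have a2 : HasDerivAt (fun w => s * (w + A)) s w := by
      simpa using ((hasDerivAt_id w).add_const A).const_mul s
    exact a1.div a2 (by positivity)
  have d5 := (hasDerivAt_arcsin (aux _ n1).1 (aux _ n1).2).comp w d3
  have d6 := (hasDerivAt_arcsin (aux _ n2).1 (aux _ n2).2).comp w d4
  refine ((d2.add (d5.const_mul A)).sub (d6.const_mul C)).congr_deriv ?_
  rw [e1, e2]
  generalize √(s ^ 2 - w ^ 2) = R at *
  have : A * (s * (w + A)) - (s ^ 2 + A * w) * s = s * C ^ 2 := by rw [hCs]; ring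
  rw [this]
  field_simp
  rw [hR2, hCs]
  ring

theorem swkb_main (ℏ μ h E : ℝ)
    (hℏ : 0 < ℏ) (hμ : 0 < μ) (hh : 0 < h) (hE : 0 < E) (hE' : E < ℏ ^ 2 * h ^ 2) :
    (∫ x in (Real.log ((h - Real.sqrt E / ℏ) / μ))..(Real.log ((h + Real.sqrt E / ℏ) / μ)),
        Real.sqrt (E - ℏ ^ 2 * (μ * Real.exp x - h) ^ 2))
      = Real.pi * (ℏ * h - Real.sqrt (ℏ ^ 2 * h ^ 2 - E)) := by
  obtain ⟨s, hs, rfl⟩ : ∃ s : ℝ, 0 < s ∧ E = s ^ 2 :=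
    ⟨√E, Real.sqrt_pos.2 hE, (Real.sq_sqrt hE.le).symm⟩
  rw [Real.sqrt_sq hs.le]
  obtain ⟨C, hC, hCd⟩ : ∃ C : ℝ, 0 < C ∧ C = √(ℏ ^ 2 * h ^ 2 - s ^ 2) :=
    ⟨_, Real.sqrt_pos.2 (by linarith), rfl⟩
  have hCs : C ^ 2 = (ℏ * h) ^ 2 - s ^ 2 := by
    rw [hCd, Real.sq_sqrt (by linarith)]; ring
  rw [← hCd]
  have hsh : s < ℏ * h := by
    apply lt_of_pow_lt_pow_left₀ 2 (by positivity); linarith [mul_pow ℏ h 2]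
  have hsd : s / ℏ < h := by rw [div_lt_iff₀ hℏ]; linarith
  have hsd0 : 0 < s / ℏ := by positivity
  have pm : 0 < (h - s / ℏ) / μ := div_pos (by linarith) hμ
  have pp : 0 < (h + s / ℏ) / μ := by positivity
  set a := Real.log ((h - s / ℏ) / μ) with ha
  set b := Real.log ((h + s / ℏ) / μ) with hb
  have wa : ℏ * (μ * exp a - h) = -s := by
    rw [ha, Real.exp_log pm]; field_simp; ring
  have wb : ℏ * (μ * exp b - h) = s := by
    rw [hb, Real.exp_log pp]; field_simp; ring
  have hab : a ≤ b := by
    apply Real.log_le_log pm; gcongr; linarith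
  have hwA : ∀ x : ℝ, 0 < ℏ * (μ * exp x - h) + ℏ * h := by
    intro x
    have : ℏ * (μ * exp x - h) + ℏ * h = ℏ * μ * exp x := by ring
    rw [this]; positivity
  have key := intervalIntegral.integral_eq_sub_of_hasDerivAt_of_le (a := a) (b := b)
    (f := (fun w => √(s ^ 2 - w ^ 2) + (ℏ * h) * arcsin (w / s)
      - C * arcsin ((s ^ 2 + (ℏ * h) * w) / (s * (w + ℏ * h)))) ∘
        (fun x => ℏ * (μ * exp x - h)))
    (f' := fun x => √(s ^ 2 - ℏ ^ 2 * (μ * exp x - h) ^ 2)) hab ?_ ?_ ?_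
  · rw [key]
    simp only [Function.comp, wa, wb]
    have q1 : (s ^ 2 + ℏ * h * s) / (s * (s + ℏ * h)) = 1 := by
      rw [div_eq_one_iff_eq (by positivity)]; ring
    have q2 : (s ^ 2 + ℏ * h * -s) / (s * (-s + ℏ * h)) = -1 := by
      have : 0 < -s + ℏ * h := by linarith
      rw [div_eq_iff (by positivity)]; ring
    rw [q1, q2, neg_div, div_self hs.ne', arcsin_neg, arcsin_one]
    simp
    ring
  · apply Continuous.continuousOn
    have : ∀ x : ℝ, s * (ℏ * (μ * exp x - h) + ℏ * h) ≠ 0 := fun x => (mul_pos hs (hwA x)).ne'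
    simp only [Function.comp_def]
    have c := Real.continuous_arcsin.comp (Continuous.div
      (f := fun x => s ^ 2 + ℏ * h * (ℏ * (μ * exp x - h)))
      (g := fun x => s * (ℏ * (μ * exp x - h) + ℏ * h)) (by fun_prop) (by fun_prop) this)
    have c2 := Real.continuous_arcsin.comp
      (by fun_prop : Continuous fun x : ℝ => ℏ * (μ * exp x - h) / s)
    exact (Continuous.add (by fun_prop) (c2.const_mul _)).sub (c.const_mul _)
  · intro x hx
    have dw : HasDerivAt (fun x => ℏ * (μ * exp x - h)) (ℏ * (μ * exp x)) x :=
      (((Real.hasDerivAt_exp x).const_mul μ).sub_const h).const_mul ℏ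
    have l1 : -s < ℏ * (μ * exp x - h) := by
      rw [← wa]; have := Real.exp_lt_exp.2 hx.1; gcongr
    have l2 : ℏ * (μ * exp x - h) < s := by
      conv_rhs => rw [← wb]
      have := Real.exp_lt_exp.2 hx.2; gcongr
    refine ((swkb_deriv s (ℏ * h) C _ hs hC hCs (hwA x) l1 l2).comp x dw).congr_deriv ?_
    have e : ℏ * (μ * exp x) = ℏ * (μ * exp x - h) + ℏ * h := by ring
    rw [e, div_mul_cancel₀ _ (hwA x).ne', mul_pow]
  · apply Continuous.intervalIntegrable
    fun_prop

/-- The SWKB integral of the Morse potential (superpotential `W x = ℏ (μ eˣ - h)`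
on `ℝ`) at energy `0 < E < ℏ²h²`, between the two turning points
`x₋ = log ((h - √E/ℏ)/μ)` and `x₊ = log ((h + √E/ℏ)/μ)`, equals
`π (ℏ h - √(ℏ²h² - E))`; in particular, for the bound-state energies
`E = ℏ² n (2h - n)` with `n ≤ h` it equals `n π ℏ`. -/
theorem swkb_integral_morse (ℏ μ h E : ℝ)
    (hℏ : 0 < ℏ) (hμ : 0 < μ) (hh : 0 < h) (hE : 0 < E) (hE' : E < ℏ ^ 2 * h ^ 2) :
    (∫ x in (Real.log ((h - Real.sqrt E / ℏ) / μ))..(Real.log ((h + Real.sqrt E / ℏ) / μ)),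
        Real.sqrt (E - ℏ ^ 2 * (μ * Real.exp x - h) ^ 2))
      = Real.pi * (ℏ * h - Real.sqrt (ℏ ^ 2 * h ^ 2 - E)) ∧
    ∀ n : ℕ, (n : ℝ) ≤ h → E = ℏ ^ 2 * n * (2 * h - n) →
      (∫ x in (Real.log ((h - Real.sqrt E / ℏ) / μ))..(Real.log ((h + Real.sqrt E / ℏ) / μ)),
          Real.sqrt (E - ℏ ^ 2 * (μ * Real.exp x - h) ^ 2))
        = n * Real.pi * ℏ := by
  refine ⟨swkb_main ℏ μ h E hℏ hμ hh hE hE', fun n hn hEn => ?_⟩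
  rw [swkb_main ℏ μ h E hℏ hμ hh hE hE']
  have e : ℏ ^ 2 * h ^ 2 - E = (ℏ * (h - n)) ^ 2 := by rw [hEn]; ring
  rw [e, Real.sqrt_sq (mul_nonneg hℏ.le (sub_nonneg.2 hn))]
  ring
end

section
/- For all real numbers ħ > 0, g > 0, c > 0 and E with 0 < E < c², let x_- = ħg/(c + √E) and x_+ = ħg/(c − √E) (the two positive roots of (c − ħg/x)² = E). Then ∫_{x_-}^{x_+} √(E − (c − ħg/x)²) dx = πħg·(c/√(c² − E) − 1). In particular, with c = e²/(2ħg) and E = e⁴/(4ħ²g²) − e⁴/(4ħ²(g+n)²) for a natural number n ≥ 1, the integral equals nπħ. -/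
open Real MeasureTheory

lemma swkb_deriv_s6 (a c k D x : ℝ) (ha : 0 < a) (hk : 0 < k) (hD : 0 < D)
    (hkD : c ^ 2 = k ^ 2 + D ^ 2) (hx : 0 < x) (hW : 0 < k ^ 2 - (c - a / x) ^ 2) :
    HasDerivAt (fun x => x * Real.sqrt (k ^ 2 - (c - a / x) ^ 2)
      + a * c / D * Real.arcsin ((D ^ 2 * x - a * c) / (a * k))
      - a * Real.arcsin ((c - a / x) / k)) (Real.sqrt (k ^ 2 - (c - a / x) ^ 2)) x := by
  set s := Real.sqrt (k ^ 2 - (c - a / x) ^ 2) with hs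
  have hs0 : 0 < s := Real.sqrt_pos.2 hW
  have hs2 : s ^ 2 = k ^ 2 - (c - a / x) ^ 2 := Real.sq_sqrt hW.le
  have hw : HasDerivAt (fun x : ℝ => c - a / x) (a / x ^ 2) x := by
    have h := ((hasDerivAt_inv hx.ne').const_mul a).const_sub c
    have h2 : HasDerivAt (fun x : ℝ => c - a / x) (-(a * -(x ^ 2)⁻¹)) x := by
      simpa only [div_eq_mul_inv] using h
    convert h2 using 1
    field_simp
  have h1 : HasDerivAt (fun x => Real.sqrt (k ^ 2 - (c - a / x) ^ 2))
      (-(c - a / x) * a / (x ^ 2 * s)) x := by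
    have h := ((hw.pow 2).const_sub (k ^ 2)).sqrt hW.ne'
    refine h.congr_deriv ?_
    simp only [Pi.pow_apply]
    rw [← hs]
    field_simp
    norm_num
    field_simp
    try ring
  have e1 : Real.sqrt (1 - ((c - a / x) / k) ^ 2) = s / k := by
    rw [Real.sqrt_eq_iff_mul_self_eq_of_pos (by positivity)]
    have : s / k * (s / k) = s ^ 2 / k ^ 2 := by ring
    rw [this, hs2]
    field_simp
  have e2 : Real.sqrt (1 - ((D ^ 2 * x - a * c) / (a * k)) ^ 2) = D * x * s / (a * k) := by
    rw [Real.sqrt_eq_iff_mul_self_eq_of_pos (by positivity)]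
    have : D * x * s / (a * k) * (D * x * s / (a * k)) = D ^ 2 * x ^ 2 * s ^ 2 / (a * k) ^ 2 := by ring
    rw [this, hs2]
    have hk2 : k ^ 2 = c ^ 2 - D ^ 2 := by linarith
    have h3 : x ^ 2 * (k ^ 2 - (c - a / x) ^ 2) = k ^ 2 * x ^ 2 - (c * x - a) ^ 2 := by
      field_simp
    rw [mul_assoc, h3, div_pow, eq_sub_iff_add_eq, ← add_div, div_eq_one_iff_eq (by positivity), mul_pow, hk2]
    ring
  have key (u b : ℝ) (f : ℝ → ℝ) (f' : ℝ) (hf : HasDerivAt f f' x) (hb : 0 < b)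
      (hu : Real.sqrt (1 - f x ^ 2) = b) :
      HasDerivAt (fun x => Real.arcsin (f x)) (1 / b * f') x := by
    have hp : 0 < 1 - f x ^ 2 := Real.sqrt_pos.1 (hu ▸ hb)
    have := (Real.hasDerivAt_arcsin (x := f x) (by nlinarith) (by nlinarith)).comp x hf
    rw [hu] at this
    exact this
  have h2 := key 0 _ _ _ (hw.div_const k) (by positivity) e1
  have h3 := key 0 _ _ _ ((((hasDerivAt_id x).const_mul (D ^ 2)).sub_const (a * c)).div_const (a * k))
    (by positivity) e2
  have h := (((hasDerivAt_id x).mul h1).add (h3.const_mul (a * c / D))).sub (h2.const_mul a)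
  refine h.congr_deriv ?_
  simp only [id]
  rw [← hs]
  field_simp
  ring

lemma swkb_main_s6 (a c k D : ℝ) (ha : 0 < a) (hc : 0 < c) (hk : 0 < k) (hD : 0 < D)
    (hkD : c ^ 2 = k ^ 2 + D ^ 2) :
    (∫ x in (a / (c + k))..(a / (c - k)), Real.sqrt (k ^ 2 - (c - a / x) ^ 2))
      = Real.pi * a * (c / D - 1) := by
  have hck : 0 < c - k := by nlinarith [sq_nonneg D, pow_pos hD 2]
  have hle : a / (c + k) ≤ a / (c - k) := by gcongr; linarith
  have hpos : 0 < a / (c + k) := by positivity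
  have hne : ∀ x ∈ Set.Icc (a / (c + k)) (a / (c - k)), x ≠ 0 := fun x hx =>
    (hpos.trans_le hx.1).ne'
  have hcs : ContinuousOn (fun x => Real.sqrt (k ^ 2 - (c - a / x) ^ 2))
      (Set.Icc (a / (c + k)) (a / (c - k))) := by
    refine ContinuousOn.sqrt (continuousOn_const.sub ((continuousOn_const.sub
      (continuousOn_const.div continuousOn_id hne)).pow 2))
  have hca : ContinuousOn (fun x => Real.arcsin ((c - a / x) / k))
      (Set.Icc (a / (c + k)) (a / (c - k))) :=
    Real.continuous_arcsin.comp_continuousOn ((continuousOn_const.sub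
      (continuousOn_const.div continuousOn_id hne)).div_const k)
  have hcb : Continuous (fun x => Real.arcsin ((D ^ 2 * x - a * c) / (a * k))) :=
    Real.continuous_arcsin.comp (by fun_prop)
  rw [intervalIntegral.integral_eq_sub_of_hasDerivAt_of_le hle
    (f := fun x => x * Real.sqrt (k ^ 2 - (c - a / x) ^ 2)
      + a * c / D * Real.arcsin ((D ^ 2 * x - a * c) / (a * k))
      - a * Real.arcsin ((c - a / x) / k))
    (((continuousOn_id.mul hcs).add (continuousOn_const.mul hcb.continuousOn)).sub
      (continuousOn_const.mul hca))]
  · have hD2 : D ^ 2 = (c - k) * (c + k) := by linarith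
    have a1 : c - a / (a / (c - k)) = k := by field_simp; ring
    have a2 : c - a / (a / (c + k)) = -k := by field_simp; ring
    have b1 : (D ^ 2 * (a / (c - k)) - a * c) / (a * k) = 1 := by
      rw [hD2]; field_simp; ring
    have b2 : (D ^ 2 * (a / (c + k)) - a * c) / (a * k) = -1 := by
      rw [hD2]; field_simp; ring
    simp only [a1, a2, b1, b2, neg_div, div_self hk.ne', Real.arcsin_neg, Real.arcsin_one, neg_sq,
      sub_self, Real.sqrt_zero]
    field_simp
    ring
  · intro x hx
    have hx0 : 0 < x := hpos.trans hx.1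
    refine swkb_deriv_s6 a c k D x ha hk hD hkD hx0 ?_
    have h1 : a / x < c + k := by
      have := (div_lt_iff₀ (by positivity)).1 hx.1
      rw [div_lt_iff₀ hx0]; linarith
    have h2 : c - k < a / x := by
      have := (lt_div_iff₀ hck).1 hx.2
      rw [lt_div_iff₀ hx0]; linarith
    nlinarith
  · exact ContinuousOn.intervalIntegrable_of_Icc hle hcs

/-- The SWKB integral of the Coulomb potential (superpotential `W x = c - ℏ g / x`
on the half line `x > 0`) at energy `0 < E < c²`, between the two positive turning
points `x₋ = ℏg/(c + √E)` and `x₊ = ℏg/(c - √E)`, equals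
`π ℏ g (c/√(c² - E) - 1)`; in particular, with `c = e²/(2ℏg)` and
`E = e⁴/(4ℏ²g²) - e⁴/(4ℏ²(g+n)²)` for a natural number `n ≥ 1`, it equals `n π ℏ`. -/
theorem swkb_integral_coulomb (ℏ g c E : ℝ)
    (hℏ : 0 < ℏ) (hg : 0 < g) (hc : 0 < c) (hE : 0 < E) (hE' : E < c ^ 2) :
    (∫ x in (ℏ * g / (c + Real.sqrt E))..(ℏ * g / (c - Real.sqrt E)),
        Real.sqrt (E - (c - ℏ * g / x) ^ 2))
      = Real.pi * ℏ * g * (c / Real.sqrt (c ^ 2 - E) - 1) ∧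
    ∀ e : ℝ, ∀ n : ℕ, 1 ≤ n →
      c = e ^ 2 / (2 * ℏ * g) →
      E = e ^ 4 / (4 * ℏ ^ 2 * g ^ 2) - e ^ 4 / (4 * ℏ ^ 2 * (g + n) ^ 2) →
      (∫ x in (ℏ * g / (c + Real.sqrt E))..(ℏ * g / (c - Real.sqrt E)),
          Real.sqrt (E - (c - ℏ * g / x) ^ 2))
        = n * Real.pi * ℏ := by
  have hm := swkb_main_s6 (ℏ * g) c (Real.sqrt E) (Real.sqrt (c ^ 2 - E)) (by positivity) hc
    (Real.sqrt_pos.2 hE) (Real.sqrt_pos.2 (by linarith))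
    (by rw [Real.sq_sqrt hE.le, Real.sq_sqrt (by linarith)]; ring)
  rw [Real.sq_sqrt hE.le, ← mul_assoc] at hm
  refine ⟨hm, fun e n hn h1 h2 => ?_⟩
  rw [hm]
  have he : e ≠ 0 := by
    rintro rfl
    norm_num at h1
    exact hc.ne' h1
  have hd : Real.sqrt (c ^ 2 - E) = e ^ 2 / (2 * ℏ * (g + n)) := by
    rw [Real.sqrt_eq_iff_mul_self_eq_of_pos (by positivity), h1, h2]
    field_simp
    ring
  rw [hd, h1]
  field_simp
  ring
end

section
/- For all real numbers ħ > 0, ω > 0, α > 0 and every natural number n, setting E = 2nħω + ħ²αn² and a = √E/ω, the extended SWKB integral of the deformed harmonic oscillator is exactly quantized: ∫_{-a}^{a} √(E − ω²x²)/(1 + αx²) dx = nπħ. -/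
open Real MeasureTheory

lemma swkb_aux_s7 (s ω α c : ℝ) (hs : 0 < s) (hω : 0 < ω) (hα : 0 < α) (hc : 0 < c)
    (h : c ^ 2 = ω ^ 2 + α * s ^ 2) :
    ∫ x in (-(s / ω))..(s / ω), Real.sqrt (s ^ 2 - ω ^ 2 * x ^ 2) / (1 + α * x ^ 2)
      = (c - ω) / α * Real.pi := by
  have hr : ∀ x : ℝ, 0 < 1 + α * x ^ 2 := fun x => by positivity
  have hrs : ∀ x : ℝ, 0 < Real.sqrt (1 + α * x ^ 2) := fun x => Real.sqrt_pos.2 (hr x)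
  have hle : -(s / ω) ≤ s / ω := by
    have : 0 < s / ω := by positivity
    linarith
  have key := intervalIntegral.integral_eq_sub_of_hasDerivAt_of_le
    (f := fun x => (1 / α) * (c * Real.arcsin (c * x / (s * Real.sqrt (1 + α * x ^ 2)))
      - ω * Real.arcsin (ω * x / s)))
    (f' := fun x => Real.sqrt (s ^ 2 - ω ^ 2 * x ^ 2) / (1 + α * x ^ 2)) hle
    (by
      apply Continuous.continuousOn
      have h1 : Continuous fun x : ℝ => c * x / (s * Real.sqrt (1 + α * x ^ 2)) :=
        Continuous.div (by fun_prop) (by fun_prop) (fun x => (mul_pos hs (hrs x)).ne')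
      have h2 : Continuous fun x : ℝ => ω * x / s := by fun_prop
      exact continuous_const.mul ((continuous_const.mul (Real.continuous_arcsin.comp h1)).sub
        (continuous_const.mul (Real.continuous_arcsin.comp h2))))
    (by
      rintro x ⟨hx1, hx2⟩
      have hx1' : -s < ω * x := by
        rw [← neg_div, div_lt_iff₀ hω] at hx1; linarith
      have hx2' : ω * x < s := by
        rw [lt_div_iff₀ hω] at hx2; linarith
      have hD : 0 < s ^ 2 - ω ^ 2 * x ^ 2 := by nlinarith
      set S := Real.sqrt (s ^ 2 - ω ^ 2 * x ^ 2) with hS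
      have hSp : 0 < S := Real.sqrt_pos.2 hD
      have hS2 : S ^ 2 = s ^ 2 - ω ^ 2 * x ^ 2 := Real.sq_sqrt hD.le
      set r := Real.sqrt (1 + α * x ^ 2) with hrdef
      have hrp : 0 < r := hrs x
      have hr2 : r ^ 2 = 1 + α * x ^ 2 := Real.sq_sqrt (hr x).le
      have e1 : 1 - (c * x / (s * r)) ^ 2 = (S / (s * r)) ^ 2 := by
        field_simp
        rw [hS2, hr2, h]; ring
      have e2 : 1 - (ω * x / s) ^ 2 = (S / s) ^ 2 := by
        field_simp
        rw [hS2]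
      have p1 : 0 < (S / (s * r)) ^ 2 := by positivity
      have p2 : 0 < (S / s) ^ 2 := by positivity
      have dr : HasDerivAt (fun x : ℝ => Real.sqrt (1 + α * x ^ 2)) (α * x / r) x := by
        have := (((hasDerivAt_pow 2 x).const_mul α).const_add 1).sqrt (hr x).ne'
        refine this.congr_deriv ?_
        rw [← hrdef]; field_simp; simp; try ring
      have du : HasDerivAt (fun x : ℝ => c * x / (s * Real.sqrt (1 + α * x ^ 2)))
          (c / (s * r ^ 3)) x := by
        have := ((hasDerivAt_id x).const_mul c).div (dr.const_mul s) (mul_pos hs hrp).ne'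
        refine HasDerivAt.congr_deriv this ?_
        simp only [id, ← hrdef]
        field_simp
        rw [hr2]; ring
      have dv : HasDerivAt (fun x : ℝ => ω * x / s) (ω / s) x := by
        simpa using ((hasDerivAt_id x).const_mul ω).div_const s
      have da := (Real.hasDerivAt_arcsin (x := c * x / (s * r))
        (by intro hh; rw [hh] at e1; norm_num at e1; linarith [e1, p1, hSp.ne', hs.ne', hrp.ne'] )
        (by intro hh; rw [hh] at e1; norm_num at e1; linarith [e1, p1])).comp x du
      have db := (Real.hasDerivAt_arcsin (x := ω * x / s)
        (by intro hh; rw [hh] at e2; norm_num at e2; linarith)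
        (by intro hh; rw [hh] at e2; norm_num at e2; linarith)).comp x dv
      have := ((da.const_mul c).sub (db.const_mul ω)).const_mul (1 / α)
      refine HasDerivAt.congr_deriv this ?_
      rw [e1, e2, Real.sqrt_sq (by positivity), Real.sqrt_sq (by positivity), ← hr2]
      field_simp
      rw [hS2, hr2, h]; ring)
    (by
      apply Continuous.intervalIntegrable
      exact Continuous.div (by fun_prop) (by fun_prop) (fun x => (hr x).ne'))
  rw [key]
  have hq : Real.sqrt (1 + α * (s / ω) ^ 2) = c / ω := by
    rw [show 1 + α * (s / ω) ^ 2 = (c / ω) ^ 2 by field_simp; linarith]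
    exact Real.sqrt_sq (by positivity)
  have a1 : c * (s / ω) / (s * (c / ω)) = 1 := by field_simp
  have a2 : ω * (s / ω) / s = 1 := by field_simp
  simp only [neg_sq, hq, mul_neg, neg_div, a1, a2, Real.arcsin_neg, Real.arcsin_one]
  field_simp
  ring

/-- The extended SWKB integral of the deformed harmonic oscillator with
position-dependent effective mass (`W x = ω x`, `η x = 1 + α x²`) is exactly
quantized at the bound-state energies `E = 2nℏω + ℏ²αn²`. -/
theorem extended_swkb_deformed_harmonic_oscillator (ℏ ω α : ℝ) (n : ℕ)
    (hℏ : 0 < ℏ) (hω : 0 < ω) (hα : 0 < α) :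
    ∫ x in
      (-(Real.sqrt (2 * n * ℏ * ω + ℏ ^ 2 * α * n ^ 2) / ω))..
      (Real.sqrt (2 * n * ℏ * ω + ℏ ^ 2 * α * n ^ 2) / ω),
      Real.sqrt ((2 * n * ℏ * ω + ℏ ^ 2 * α * n ^ 2) - ω ^ 2 * x ^ 2) / (1 + α * x ^ 2)
      = n * Real.pi * ℏ := by
  rcases Nat.eq_zero_or_pos n with rfl | hn
  · simp
  have hn' : (0 : ℝ) < n := by exact_mod_cast hn
  have hE : 0 < 2 * n * ℏ * ω + ℏ ^ 2 * α * n ^ 2 := by positivity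
  have hsq := Real.sq_sqrt hE.le
  have := swkb_aux_s7 (Real.sqrt (2 * n * ℏ * ω + ℏ ^ 2 * α * n ^ 2)) ω α (ω + ℏ * α * n)
    (Real.sqrt_pos.2 hE) hω hα (by positivity) (by rw [hsq]; ring)
  rw [hsq] at this
  rw [this]
  field_simp
  ring
end

section
/- For all real numbers ħ > 0, ω > 0, a > 0 and every natural number n ≥ 1, let x_± = (nħ ± √(n²ħ² + 2nħωa²))/(ωa) be the two roots of aω²x² = 2nħω(x + a) (both lying in x > −a, with x_- < 0 < x_+). Then the extended SWKB integral of the semi-confined harmonic oscillator is exactly quantized: ∫_{x_-}^{x_+} √((a/(x+a))·(2nħω − aω²x²/(x+a))) dx = nπħ. -/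
open Real MeasureTheory

lemma swkb_aux_s8 (p q g : ℝ) (hp : 0 < p) (hpq : p < q) (hg : 0 < g) (hgg : g ^ 2 = p * q) :
    ∫ y in p..q, Real.sqrt ((y - p) * (q - y)) / y = Real.pi * ((p + q) / 2 - g) := by
  have hq : 0 < q := hp.trans hpq
  have hd : 0 < q - p := sub_pos.2 hpq
  have key := intervalIntegral.integral_eq_sub_of_hasDerivAt_of_le (a := p) (b := q)
    (f := fun y => Real.sqrt ((y - p) * (q - y)) + (p + q) / 2 * Real.arcsin ((2 * y - p - q) / (q - p))
      - g * Real.arcsin (((p + q) - 2 * g ^ 2 / y) / (q - p)))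
    (f' := fun y => Real.sqrt ((y - p) * (q - y)) / y) hpq.le ?_ ?_ ?_
  · rw [key]
    have e1 : (2 * q - p - q) / (q - p) = 1 := by
      rw [div_eq_one_iff_eq hd.ne']; ring
    have e2 : (2 * p - p - q) / (q - p) = -1 := by
      rw [div_eq_iff hd.ne']; ring
    have e3 : ((p + q) - 2 * g ^ 2 / q) / (q - p) = 1 := by
      rw [hgg]; field_simp; ring
    have e4 : ((p + q) - 2 * g ^ 2 / p) / (q - p) = -1 := by
      rw [hgg]; field_simp; ring
    simp only [e1, e2, e3, e4, Real.arcsin_one, Real.arcsin_neg_one, sub_self, zero_mul, mul_zero,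
      Real.sqrt_zero]
    ring
  · have : ∀ y ∈ Set.Icc p q, y ≠ 0 := fun y hy => (hp.trans_le hy.1).ne'
    have h1 : ContinuousOn (fun y : ℝ => ((p + q) - 2 * g ^ 2 / y) / (q - p)) (Set.Icc p q) :=
      (continuousOn_const.sub (continuousOn_const.div continuousOn_id this)).div_const _
    refine ContinuousOn.sub (Continuous.continuousOn ?_)
      (continuousOn_const.mul (Real.continuous_arcsin.comp_continuousOn h1))
    exact (by fun_prop : Continuous fun y : ℝ => Real.sqrt ((y - p) * (q - y))).add
      (continuous_const.mul (Real.continuous_arcsin.comp (by fun_prop)))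
  · intro y hy
    have hy0 : 0 < y := hp.trans hy.1
    have ha : 0 < y - p := sub_pos.2 hy.1
    have hb : 0 < q - y := sub_pos.2 hy.2
    have hab := mul_pos ha hb
    set R := Real.sqrt ((y - p) * (q - y)) with hR
    have hRp : 0 < R := Real.sqrt_pos.2 hab
    have hR2 : R ^ 2 = (y - p) * (q - y) := Real.sq_sqrt hab.le
    have s1 : 1 - ((2 * y - p - q) / (q - p)) ^ 2 = (2 * R / (q - p)) ^ 2 := by
      rw [div_pow, div_pow, mul_pow, hR2]; field_simp; ring
    have s2 : 1 - (((p + q) - 2 * g ^ 2 / y) / (q - p)) ^ 2 = (2 * g * R / (y * (q - p))) ^ 2 := by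
      rw [div_pow, div_pow, mul_pow, mul_pow, hR2, hgg]; field_simp; ring
    have p1 : 0 < 2 * R / (q - p) := by positivity
    have p2 : 0 < 2 * g * R / (y * (q - p)) := by positivity
    have d1 : HasDerivAt (fun y : ℝ => (2 * y - p - q) / (q - p)) (2 / (q - p)) y := by
      have := ((((hasDerivAt_id y).const_mul 2).sub_const p).sub_const q).div_const (q - p)
      simpa using this
    have d2 : HasDerivAt (fun y : ℝ => ((p + q) - 2 * g ^ 2 / y) / (q - p))
        (2 * g ^ 2 / y ^ 2 / (q - p)) y := by
      have := ((((hasDerivAt_inv hy0.ne').const_mul (2 * g ^ 2)).const_sub (p + q))).div_const (q - p)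
      refine HasDerivAt.congr_deriv (f := fun y : ℝ => ((p + q) - 2 * g ^ 2 / y) / (q - p)) this ?_
      field_simp
    have d3 : HasDerivAt (fun y : ℝ => (y - p) * (q - y)) (p + q - 2 * y) y := by
      have := ((hasDerivAt_id y).sub_const p).mul ((hasDerivAt_id y).const_sub q)
      refine HasDerivAt.congr_deriv (f := fun y : ℝ => (y - p) * (q - y)) this ?_
      simp only [id]; ring
    have a1 := Real.hasDerivAt_arcsin (x := (2 * y - p - q) / (q - p))
      (by intro h; rw [h] at s1; nlinarith [sq_pos_of_pos p1])
      (by intro h; rw [h] at s1; nlinarith [sq_pos_of_pos p1])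
    have a2 := Real.hasDerivAt_arcsin (x := ((p + q) - 2 * g ^ 2 / y) / (q - p))
      (by intro h; rw [h] at s2; nlinarith [sq_pos_of_pos p2])
      (by intro h; rw [h] at s2; nlinarith [sq_pos_of_pos p2])
    rw [s1, Real.sqrt_sq p1.le] at a1
    rw [s2, Real.sqrt_sq p2.le] at a2
    have D := ((d3.sqrt hab.ne').add ((a1.comp y d1).const_mul ((p + q) / 2))).sub
      ((a2.comp y d2).const_mul g)
    refine HasDerivAt.congr_deriv D ?_
    rw [← hR]
    field_simp
    rw [hR2, hgg]; ring
  · refine ContinuousOn.intervalIntegrable ?_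
    rw [Set.uIcc_of_le hpq.le]
    exact (by fun_prop : Continuous fun y : ℝ => Real.sqrt ((y - p) * (q - y))).continuousOn.div
      continuousOn_id (fun y hy => (hp.trans_le hy.1).ne')

/-- The extended SWKB integral of the semi-confined harmonic oscillator with
position-dependent effective mass (`W x = ω x √(a/(x+a))`, `η x = √((x+a)/a)` on
`x > -a`) is exactly quantized at the bound-state energies `E = 2nℏω`, the
turning points being `x₋ < 0 < x₊` with `x₊ = (nℏ ± √(n²ℏ² + 2nℏωa²))/(ωa)`. -/
theorem extended_swkb_semi_confined_harmonic_oscillator (ℏ ω a : ℝ) (n : ℕ)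
    (hℏ : 0 < ℏ) (hω : 0 < ω) (ha : 0 < a) (hn : 1 ≤ n) :
    ∫ x in
      ((n * ℏ - Real.sqrt ((n : ℝ) ^ 2 * ℏ ^ 2 + 2 * n * ℏ * ω * a ^ 2)) / (ω * a))..
      ((n * ℏ + Real.sqrt ((n : ℝ) ^ 2 * ℏ ^ 2 + 2 * n * ℏ * ω * a ^ 2)) / (ω * a)),
      Real.sqrt ((a / (x + a)) * (2 * n * ℏ * ω - a * ω ^ 2 * x ^ 2 / (x + a)))
      = n * Real.pi * ℏ := by
  have hN : (0 : ℝ) < n := by exact_mod_cast hn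
  set N : ℝ := (n : ℝ)
  have hD : 0 < N ^ 2 * ℏ ^ 2 + 2 * N * ℏ * ω * a ^ 2 := by positivity
  set S := Real.sqrt (N ^ 2 * ℏ ^ 2 + 2 * N * ℏ * ω * a ^ 2) with hS
  have hSp : 0 < S := Real.sqrt_pos.2 hD
  have hS2 : S ^ 2 = N ^ 2 * ℏ ^ 2 + 2 * N * ℏ * ω * a ^ 2 := Real.sq_sqrt hD.le
  have hwa : 0 < ω * a := by positivity
  obtain ⟨p, hpd⟩ : ∃ p, p = (N * ℏ - S) / (ω * a) + a := ⟨_, rfl⟩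
  obtain ⟨q, hqd⟩ : ∃ q, q = (N * ℏ + S) / (ω * a) + a := ⟨_, rfl⟩
  have hq : 0 < q := by rw [hqd]; positivity
  have hprod : a ^ 2 = p * q := by
    rw [hpd, hqd]; field_simp; linear_combination hS2
  have hsum : p + q = 2 * (N * ℏ) / (ω * a) + 2 * a := by rw [hpd, hqd]; ring
  have hp : 0 < p := by
    have : 0 < p * q := by rw [← hprod]; positivity
    exact pos_of_mul_pos_left this hq.le
  have hpq : p < q := by
    rw [hpd, hqd]; gcongr; linarith
  have e := swkb_aux_s8 p q a hp hpq ha hprod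
  have hshift := intervalIntegral.integral_comp_add_right
    (a := (N * ℏ - S) / (ω * a)) (b := (N * ℏ + S) / (ω * a))
    (fun y => ω * a * (Real.sqrt ((y - p) * (q - y)) / y)) a
  rw [← hpd, ← hqd, intervalIntegral.integral_const_mul (a := p), e, hsum] at hshift
  have hle : (N * ℏ - S) / (ω * a) ≤ (N * ℏ + S) / (ω * a) := by
    linarith
  rw [intervalIntegral.integral_congr (g := fun x =>
    ω * a * (Real.sqrt ((x + a - p) * (q - (x + a))) / (x + a))), hshift]
  · field_simp; ring
  · intro x hx
    rw [Set.uIcc_of_le hle] at hx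
    have hy : 0 < x + a := by linarith [hx.1]
    have hab : 0 ≤ (x + a - p) * (q - (x + a)) :=
      mul_nonneg (by linarith [hx.1]) (by linarith [hx.2])
    have : (a / (x + a)) * (2 * N * ℏ * ω - a * ω ^ 2 * x ^ 2 / (x + a))
        = (ω * a / (x + a)) ^ 2 * ((x + a - p) * (q - (x + a))) := by
      have h : (x + a - p) * (q - (x + a))
          = (2 * (N * ℏ) / (ω * a) + 2 * a) * (x + a) - (x + a) ^ 2 - a ^ 2 := by
        rw [← hsum, hprod]; ring
      rw [h]; field_simp; ring
    simp only
    rw [this, Real.sqrt_mul (sq_nonneg _), Real.sqrt_sq (by positivity)]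
    ring
end

section
/- For all real numbers ω > 0, γ > 0 and E ≥ 0, with a_L = −2√E/((1+γ)ω) and a_R = 2γ√E/((1+γ)ω), the SWKB integral of the piecewise-linear superpotential W(x) = ((1+γ)/2)ωx for x < 0 and W(x) = ((1+γ)/(2γ))ωx for x > 0 satisfies ∫_{a_L}^{0} √(E − ((1+γ)/2)²ω²x²) dx + ∫_{0}^{a_R} √(E − ((1+γ)/(2γ))²ω²x²) dx = πE/(2ω). -/
open Real MeasureTheory

theorem quarter_ellipse_aux (s c : ℝ) (hs : 0 ≤ s) (hc : 0 < c) :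
    ∫ x in (0 : ℝ)..(s / c), Real.sqrt (s ^ 2 - c ^ 2 * x ^ 2) = Real.pi * s ^ 2 / (4 * c) := by
  have h := intervalIntegral.integral_comp_mul_deriv (a := 0) (b := Real.pi / 2)
    (f := fun t => s / c * Real.sin t) (f' := fun t => s / c * Real.cos t)
    (g := fun x => Real.sqrt (s ^ 2 - c ^ 2 * x ^ 2))
    (fun t _ => (Real.hasDerivAt_sin t).const_mul _) (by fun_prop) (by fun_prop)
  simp only [Real.sin_zero, Real.sin_pi_div_two, mul_zero, mul_one] at h
  rw [← h]
  have h2 : ∫ t in (0 : ℝ)..(Real.pi / 2), s ^ 2 / c * Real.cos t ^ 2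
      = Real.pi * s ^ 2 / (4 * c) := by
    rw [intervalIntegral.integral_const_mul, integral_cos_sq]
    simp
    field_simp
    ring
  rw [← h2]
  apply intervalIntegral.integral_congr
  intro t ht
  rw [Set.uIcc_of_le (by positivity)] at ht
  have hcos : 0 ≤ Real.cos t :=
    Real.cos_nonneg_of_mem_Icc ⟨by linarith [ht.1, Real.pi_pos], ht.2⟩
  have e : s ^ 2 - c ^ 2 * (s / c * Real.sin t) ^ 2 = (s * Real.cos t) ^ 2 := by
    rw [mul_pow s, Real.cos_sq']
    field_simp
  simp only [Function.comp]
  rw [e, Real.sqrt_sq (by positivity)]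
  ring

/-- The SWKB integral of the piecewise-linear superpotential
`W x = ((1+γ)/2) ω x` for `x < 0` and `W x = ((1+γ)/(2γ)) ω x` for `x > 0`
(obtained from the inverse SWKB problem with the modulated-symmetry ansatz
`a_R = -γ a_L`) at energy `E ≥ 0` equals `π E / (2 ω)`. -/
theorem swkb_integral_piecewise_linear_superpotential (ω γ E : ℝ)
    (hω : 0 < ω) (hγ : 0 < γ) (hE : 0 ≤ E) :
    (∫ x in (-(2 * Real.sqrt E / ((1 + γ) * ω)))..(0 : ℝ),
        Real.sqrt (E - ((1 + γ) / 2) ^ 2 * ω ^ 2 * x ^ 2))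
    + (∫ x in (0 : ℝ)..(2 * γ * Real.sqrt E / ((1 + γ) * ω)),
        Real.sqrt (E - ((1 + γ) / (2 * γ)) ^ 2 * ω ^ 2 * x ^ 2))
      = Real.pi * E / (2 * ω) := by
  have hl := quarter_ellipse_aux (Real.sqrt E) ((1 + γ) / 2 * ω) (Real.sqrt_nonneg E) (by positivity)
  have hr := quarter_ellipse_aux (Real.sqrt E) ((1 + γ) / (2 * γ) * ω) (Real.sqrt_nonneg E)
    (by positivity)
  have el : Real.sqrt E / ((1 + γ) / 2 * ω) = 2 * Real.sqrt E / ((1 + γ) * ω) := by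
    field_simp
  have er : Real.sqrt E / ((1 + γ) / (2 * γ) * ω) = 2 * γ * Real.sqrt E / ((1 + γ) * ω) := by
    field_simp
  rw [el] at hl
  rw [er] at hr
  simp only [Real.sq_sqrt hE, mul_pow _ ω] at hl hr
  have hn := intervalIntegral.integral_comp_neg (a := 0) (b := 2 * Real.sqrt E / ((1 + γ) * ω))
    (fun x => Real.sqrt (E - ((1 + γ) / 2) ^ 2 * ω ^ 2 * x ^ 2))
  simp only [neg_sq, neg_zero] at hn
  rw [← hn, hl, hr]
  field_simp
  ring
end

section
/- Let E > 0 and let W : ℝ → ℝ be differentiable on an interval [a, b] with continuous derivative, satisfying W(a) = −√E, W(b) = √E, and W(x)² < E for all x in the open interval (a, b). If the function x ↦ W'(x)/√(E − W(x)²) is interval-integrable on [a, b], then ∫_{a}^{b} W'(x)/√(E − W(x)²) dx = π. -/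
open Real MeasureTheory

/-- The first-order correction term in the formal derivation of the SWKB
condition: if `W` is differentiable on `[a, b]` with continuous derivative `W'`,
`W a = -√E`, `W b = √E`, and `W x ^ 2 < E` on `(a, b)`, and
`x ↦ W' x / √(E - W x ^ 2)` is interval-integrable on `[a, b]`, then
`∫_a^b W' x / √(E - W x ^ 2) dx = π`. -/
theorem integral_deriv_div_sqrt_eq_pi (E : ℝ) (hE : 0 < E)
    (a b : ℝ) (hab : a ≤ b) (W W' : ℝ → ℝ)
    (hW : ∀ x ∈ Set.Icc a b, HasDerivAt W (W' x) x)
    (hW' : ContinuousOn W' (Set.Icc a b))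
    (hWa : W a = -Real.sqrt E) (hWb : W b = Real.sqrt E)
    (hlt : ∀ x ∈ Set.Ioo a b, W x ^ 2 < E)
    (hint : IntervalIntegrable (fun x => W' x / Real.sqrt (E - W x ^ 2))
      MeasureTheory.volume a b) :
    ∫ x in a..b, W' x / Real.sqrt (E - W x ^ 2) = Real.pi := by
  have hs : 0 < √E := Real.sqrt_pos.2 hE
  have hsq : √E ^ 2 = E := Real.sq_sqrt hE.le
  have key := intervalIntegral.integral_eq_sub_of_hasDerivAt_of_le
    (f := fun x => Real.arcsin (W x / √E)) hab ?_ ?_ hint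
  · rw [key]
    simp only [hWa, hWb, neg_div, div_self hs.ne', Real.arcsin_neg, Real.arcsin_one]
    ring
  · have hc : ContinuousOn W (Set.Icc a b) :=
      fun x hx => (hW x hx).continuousAt.continuousWithinAt
    exact Real.continuous_arcsin.comp_continuousOn (hc.div_const _)
  · intro x hx
    have h := hlt x hx
    have h1 : W x / √E ≠ -1 := by
      intro h1
      rw [div_eq_iff hs.ne'] at h1
      rw [h1] at h
      nlinarith
    have h2 : W x / √E ≠ 1 := by
      intro h1
      rw [div_eq_iff hs.ne'] at h1
      rw [h1] at h
      nlinarith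
    have hd := (Real.hasDerivAt_arcsin h1 h2).comp x
      ((hW x (Set.Ioo_subset_Icc_self hx)).div_const (√E))
    have he : √(E - W x ^ 2) = √(1 - (W x / √E) ^ 2) * √E := by
      rw [← Real.sqrt_mul' _ hE.le, div_pow, hsq]
      congr 1
      field_simp
    refine hd.congr_deriv ?_
    rw [he, div_mul_div_comm, one_mul]
end

section
/- For all real numbers a, b with 0 < a < b, ∫_{a}^{b} √((y − a)(b − y))/y dy = π(a + b)/2 − π√(ab). -/
open Real MeasureTheory

/-- Closed-form integral formula used for SWKB integrals of conventional
shape-invariant potentials: for `0 < a < b`,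
`∫_a^b √((y - a)(b - y))/y dy = π(a + b)/2 - π √(ab)`. -/
theorem integral_sqrt_div_self (a b : ℝ) (ha : 0 < a) (hab : a < b) :
    ∫ y in a..b, Real.sqrt ((y - a) * (b - y)) / y
      = Real.pi * (a + b) / 2 - Real.pi * Real.sqrt (a * b) := by
  have hb : 0 < b := ha.trans hab
  have hd : 0 < b - a := sub_pos.2 hab
  have hs : 0 < Real.sqrt (a * b) := Real.sqrt_pos.2 (mul_pos ha hb)
  have hs2 : Real.sqrt (a * b) ^ 2 = a * b := Real.sq_sqrt (mul_pos ha hb).le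
  have key := intervalIntegral.integral_eq_sub_of_hasDerivAt_of_le (a := a) (b := b)
    (f := fun y => Real.sqrt ((y - a) * (b - y))
      + (a + b) / 2 * Real.arcsin ((2 * y - a - b) / (b - a))
      - Real.sqrt (a * b) * Real.arcsin (((a + b) * y - 2 * a * b) / (y * (b - a))))
    (f' := fun y => Real.sqrt ((y - a) * (b - y)) / y) hab.le ?_ ?_ ?_
  · rw [key]
    have e1 : (2 * b - a - b) / (b - a) = 1 := by
      rw [div_eq_one_iff_eq hd.ne']; ring
    have e2 : (2 * a - a - b) / (b - a) = -1 := by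
      rw [div_eq_iff hd.ne']; ring
    have e3 : ((a + b) * b - 2 * a * b) / (b * (b - a)) = 1 := by
      rw [div_eq_one_iff_eq (by positivity)]; ring
    have e4 : ((a + b) * a - 2 * a * b) / (a * (b - a)) = -1 := by
      rw [div_eq_iff (by positivity)]; ring
    simp only [e1, e2, e3, e4, Real.arcsin_one, Real.arcsin_neg_one, sub_self, mul_zero, zero_mul,
      Real.sqrt_zero]
    ring
  · have hne : ∀ y ∈ Set.Icc a b, y * (b - a) ≠ 0 := fun y hy =>
      (mul_pos (ha.trans_le hy.1) hd).ne'
    have h3 : ContinuousOn (fun y => ((a + b) * y - 2 * a * b) / (y * (b - a))) (Set.Icc a b) :=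
      ContinuousOn.div (by fun_prop) (by fun_prop) hne
    have h4 := Real.continuous_arcsin.comp_continuousOn h3
    refine ContinuousOn.sub (Continuous.continuousOn ?_) (continuousOn_const.mul h4)
    have : Continuous fun y : ℝ => Real.arcsin ((2 * y - a - b) / (b - a)) :=
      Real.continuous_arcsin.comp (by fun_prop)
    fun_prop
  · intro y hy
    have hy1 : 0 < y - a := sub_pos.2 hy.1
    have hy2 : 0 < b - y := sub_pos.2 hy.2
    have hy0 : 0 < y := ha.trans hy.1
    have hp : 0 < (y - a) * (b - y) := mul_pos hy1 hy2
    have hR : 0 < Real.sqrt ((y - a) * (b - y)) := Real.sqrt_pos.2 hp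
    have hR2 : Real.sqrt ((y - a) * (b - y)) ^ 2 = (y - a) * (b - y) := Real.sq_sqrt hp.le
    have d1 : HasDerivAt (fun y => (y - a) * (b - y)) (1 * (b - y) + (y - a) * (-1)) y :=
      ((hasDerivAt_id y).sub_const a).mul ((hasDerivAt_id y).const_sub b)
    have d2 : HasDerivAt (fun y => (2 * y - a - b) / (b - a)) ((2 * 1) / (b - a)) y :=
      (((((hasDerivAt_id y).const_mul 2).sub_const a).sub_const b).div_const (b - a))
    have d3 : HasDerivAt (fun y => ((a + b) * y - 2 * a * b) / (y * (b - a)))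
        ((((a + b) * 1) * (y * (b - a)) - ((a + b) * y - 2 * a * b) * (1 * (b - a)))
          / (y * (b - a)) ^ 2) y :=
      ((((hasDerivAt_id y).const_mul (a + b)).sub_const (2 * a * b))).div
        ((hasDerivAt_id y).mul_const (b - a)) (by positivity)
    set R := Real.sqrt ((y - a) * (b - y)) with hRdef
    set s := Real.sqrt (a * b) with hsdef
    have q2 : 1 - ((2 * y - a - b) / (b - a)) ^ 2 = (2 * R / (b - a)) ^ 2 := by
      have : (2 * R / (b - a)) ^ 2 = 4 * ((y - a) * (b - y)) / (b - a) ^ 2 := by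
        rw [← hR2, div_pow]; ring
      rw [this]; field_simp; ring
    have q3 : 1 - (((a + b) * y - 2 * a * b) / (y * (b - a))) ^ 2
        = (2 * s * R / (y * (b - a))) ^ 2 := by
      have : (2 * s * R / (y * (b - a))) ^ 2
          = 4 * (a * b) * ((y - a) * (b - y)) / (y * (b - a)) ^ 2 := by
        rw [← hR2, ← hs2, div_pow]; ring
      rw [this]; field_simp; ring
    have p2 : 0 < 2 * R / (b - a) := by positivity
    have p3 : 0 < 2 * s * R / (y * (b - a)) := by positivity
    have ne : ∀ u w : ℝ, 0 < w → 1 - u ^ 2 = w ^ 2 → u ≠ -1 ∧ u ≠ 1 := by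
      intro u w hw h
      constructor <;> · rintro rfl; nlinarith [pow_pos hw 2]
    have n2 := ne _ _ p2 q2
    have n3 := ne _ _ p3 q3
    have D2 := (Real.hasDerivAt_arcsin n2.1 n2.2).comp y d2
    have D3 := (Real.hasDerivAt_arcsin n3.1 n3.2).comp y d3
    rw [q2, Real.sqrt_sq p2.le] at D2
    rw [q3, Real.sqrt_sq p3.le] at D3
    refine (((d1.sqrt hp.ne').add (D2.const_mul ((a + b) / 2))).sub (D3.const_mul s)).congr_deriv ?_
    rw [← hRdef]
    field_simp
    rw [hR2]
    ring
  · apply ContinuousOn.intervalIntegrable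
    rw [Set.uIcc_of_le hab.le]
    exact ContinuousOn.div (by fun_prop) (by fun_prop) fun y hy => (ha.trans_le hy.1).ne'
end

section
/- For all real numbers a < b, ∫_{a}^{b} √((y − a)(b − y))/(y² + 1) dy = (π/√2)·√(√((1 + a²)(1 + b²)) − ab + 1) − π. -/
open Real MeasureTheory

namespace SWKB
open Set Filter Topology

lemma w_deriv (a b y : ℝ) (h1 : a < y) (h2 : y < b) :
    HasDerivAt (fun y => √((y - a) * (b - y)))
      (((b - y) - (y - a)) / (2 * √((y - a) * (b - y)))) y := by
  have h : HasDerivAt (fun y => (y - a) * (b - y)) ((b - y) - (y - a)) y := by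
    have := ((hasDerivAt_id y).sub_const a).mul ((hasDerivAt_id y).const_sub b)
    refine this.congr_deriv ?_
    simp only [id_eq]; ring
  exact h.sqrt (mul_pos (sub_pos.2 h1) (sub_pos.2 h2)).ne'

lemma N_deriv (a b r s y : ℝ) :
    HasDerivAt (fun y => r * (y - a) - s * (b - y)) (r + s) y := by
  have := (((hasDerivAt_id y).sub_const a).const_mul r).sub
    (((hasDerivAt_id y).const_sub b).const_mul s)
  refine this.congr_deriv ?_
  ring

lemma arctan_deriv (a b r s c y : ℝ) (h1 : a < y) (h2 : y < b) (hc : 0 < c) :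
    HasDerivAt (fun y => arctan ((r * (y - a) - s * (b - y)) / (c * √((y - a) * (b - y)))))
      (c * (b - a) * (r * (y - a) + s * (b - y)) /
        (2 * √((y - a) * (b - y)) *
          (c ^ 2 * ((y - a) * (b - y)) + (r * (y - a) - s * (b - y)) ^ 2))) y := by
  have hp := mul_pos (sub_pos.2 h1) (sub_pos.2 h2)
  have hw := Real.sqrt_pos.2 hp
  have hsq := Real.sq_sqrt hp.le
  have h0 : HasDerivAt (fun y => (r * (y - a) - s * (b - y)) / (c * √((y - a) * (b - y)))) _ y :=
    (N_deriv a b r s y).div ((w_deriv a b y h1 h2).const_mul c) (by positivity)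
  refine h0.arctan.congr_deriv ?_
  symm
  set w := √((y - a) * (b - y))
  rw [← hsq]
  have hD : 0 < c ^ 2 * w ^ 2 + (r * (y - a) - s * (b - y)) ^ 2 := by positivity
  have e : 1 + ((r * (y - a) - s * (b - y)) / (c * w)) ^ 2 =
    (c ^ 2 * w ^ 2 + (r * (y - a) - s * (b - y)) ^ 2) / (c * w) ^ 2 := by
    field_simp
  rw [e]
  have e2 : (r + s) * (c * w) - (r * (y - a) - s * (b - y)) * (c * ((b - y - (y - a)) / (2 * w)))
     = c * (b - a) * (r * (y - a) + s * (b - y)) / (2 * w) := by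
    field_simp
    rw [hsq]; ring
  rw [e2]
  field_simp

lemma log_deriv (a b r s q y : ℝ) (h1 : a < y) (h2 : y < b)
    (hm : 0 < r * (y - a) + s * (b - y) - q * √((y - a) * (b - y)))
    (hpl : 0 < r * (y - a) + s * (b - y) + q * √((y - a) * (b - y))) :
    HasDerivAt (fun y => log (r * (y - a) + s * (b - y) - q * √((y - a) * (b - y)))
        - log (r * (y - a) + s * (b - y) + q * √((y - a) * (b - y))))
      (q * (b - a) * (r * (y - a) - s * (b - y)) /
        (√((y - a) * (b - y)) *
          ((r * (y - a) + s * (b - y)) ^ 2 - q ^ 2 * ((y - a) * (b - y))))) y := by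
  have hp := mul_pos (sub_pos.2 h1) (sub_pos.2 h2)
  have hw := Real.sqrt_pos.2 hp
  have hsq := Real.sq_sqrt hp.le
  have hL : HasDerivAt (fun y => r * (y - a) + s * (b - y)) (r - s) y := by
    simpa [sub_eq_add_neg] using N_deriv a b r (-s) y
  have hq := (w_deriv a b y h1 h2).const_mul q
  have k1 : HasDerivAt (fun y => r * (y - a) + s * (b - y) - q * √((y - a) * (b - y))) _ y :=
    hL.sub hq
  have k2 : HasDerivAt (fun y => r * (y - a) + s * (b - y) + q * √((y - a) * (b - y))) _ y :=
    hL.add hq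
  refine ((k1.log hm.ne').sub (k2.log hpl.ne')).congr_deriv ?_
  symm
  set w := √((y - a) * (b - y))
  rw [← hsq]
  have e : (r * (y - a) + s * (b - y)) ^ 2 - q ^ 2 * w ^ 2 =
    (r * (y - a) + s * (b - y) - q * w) * (r * (y - a) + s * (b - y) + q * w) := by ring
  rw [e, div_sub_div _ _ hm.ne' hpl.ne', div_eq_div_iff (by positivity) (by positivity)]
  have e2 : (r - s - q * ((b - y - (y - a)) / (2 * w))) * (r * (y - a) + s * (b - y) + q * w) -
     (r * (y - a) + s * (b - y) - q * w) * (r - s + q * ((b - y - (y - a)) / (2 * w)))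
     = q * (b - a) * (r * (y - a) - s * (b - y)) / w := by
    field_simp
    ring_nf
    rw [hsq]; ring
  rw [e2]
  field_simp

lemma w_tendsto (a b x : ℝ) (hx : (x - a) * (b - x) = 0) (S : Set ℝ) (hS : S ⊆ Ioo a b) (c : ℝ)
    (hc : 0 < c) :
    Tendsto (fun y => (c * √((y - a) * (b - y)))⁻¹) (𝓝[S] x) atTop := by
  apply Tendsto.inv_tendsto_nhdsGT_zero
  rw [tendsto_nhdsWithin_iff]
  constructor
  · have : Continuous (fun y => c * √((y - a) * (b - y))) := by fun_prop
    have := this.tendsto x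
    simp only [hx, Real.sqrt_zero, mul_zero] at this
    exact this.mono_left nhdsWithin_le_nhds
  · filter_upwards [self_mem_nhdsWithin] with y hy
    have := hS hy
    exact mul_pos hc (Real.sqrt_pos.2 (mul_pos (sub_pos.2 this.1) (sub_pos.2 this.2)))

lemma arctan_right (a b r s c : ℝ) (hab : a < b) (hr : 0 < r) (hc : 0 < c) :
    Tendsto (fun y => arctan ((r * (y - a) - s * (b - y)) / (c * √((y - a) * (b - y)))))
      (𝓝[<] b) (𝓝 (π / 2)) := by
  rw [← nhdsWithin_Ioo_eq_nhdsLT hab]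
  have h1 := w_tendsto a b b (by simp) (Ioo a b) subset_rfl c hc
  have h2 : Tendsto (fun y => r * (y - a) - s * (b - y)) (𝓝[Ioo a b] b) (𝓝 (r * (b - a))) := by
    have := (N_deriv a b r s b).continuousAt.tendsto
    simp only [sub_self, mul_zero, sub_zero] at this
    exact this.mono_left nhdsWithin_le_nhds
  have := h2.pos_mul_atTop (mul_pos hr (sub_pos.2 hab)) h1
  exact (tendsto_arctan_atTop.mono_right nhdsWithin_le_nhds).comp this

lemma arctan_left (a b r s c : ℝ) (hab : a < b) (hs : 0 < s) (hc : 0 < c) :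
    Tendsto (fun y => arctan ((r * (y - a) - s * (b - y)) / (c * √((y - a) * (b - y)))))
      (𝓝[>] a) (𝓝 (-(π / 2))) := by
  rw [← nhdsWithin_Ioo_eq_nhdsGT hab]
  have h1 := w_tendsto a b a (by simp) (Ioo a b) subset_rfl c hc
  have h2 : Tendsto (fun y => r * (y - a) - s * (b - y)) (𝓝[Ioo a b] a) (𝓝 (- (s * (b - a)))) := by
    have := (N_deriv a b r s a).continuousAt.tendsto
    simp only [sub_self, mul_zero, zero_sub] at this
    exact this.mono_left nhdsWithin_le_nhds
  have := h2.neg_mul_atTop (neg_lt_zero.2 (mul_pos hs (sub_pos.2 hab))) h1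
  exact (tendsto_arctan_atBot.mono_right nhdsWithin_le_nhds).comp this

lemma log_tendsto (a b r s q x : ℝ) (hx : (x - a) * (b - x) = 0)
    (h : r * (x - a) + s * (b - x) ≠ 0) (S : Set ℝ) :
    Tendsto (fun y => log (r * (y - a) + s * (b - y) - q * √((y - a) * (b - y)))
        - log (r * (y - a) + s * (b - y) + q * √((y - a) * (b - y)))) (𝓝[S] x) (𝓝 0) := by
  have : ContinuousAt (fun y => log (r * (y - a) + s * (b - y) - q * √((y - a) * (b - y)))
        - log (r * (y - a) + s * (b - y) + q * √((y - a) * (b - y)))) x := by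
    apply ContinuousAt.sub
    · apply ContinuousAt.log (by fun_prop)
      simpa [hx] using h
    · apply ContinuousAt.log (by fun_prop)
      simpa [hx] using h
  have := this.tendsto
  simp only [hx, Real.sqrt_zero, mul_zero, sub_zero, add_zero, sub_self] at this
  exact this.mono_left nhdsWithin_le_nhds

end SWKB

/-- Closed-form integral formula used for SWKB integrals of conventional
shape-invariant potentials: for `a < b`,
`∫_a^b √((y - a)(b - y))/(y² + 1) dy
  = (π/√2) √(√((1 + a²)(1 + b²)) - ab + 1) - π`. -/
theorem integral_sqrt_div_sq_add_one (a b : ℝ) (hab : a < b) :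
    ∫ y in a..b, Real.sqrt ((y - a) * (b - y)) / (y ^ 2 + 1)
      = Real.pi / Real.sqrt 2 *
          Real.sqrt (Real.sqrt ((1 + a ^ 2) * (1 + b ^ 2)) - a * b + 1) - Real.pi := by
  have hba : 0 < b - a := sub_pos.2 hab
  obtain ⟨α, hα, hα2⟩ : ∃ α : ℝ, 0 < α ∧ α ^ 2 = 1 + a ^ 2 :=
    ⟨√(1 + a ^ 2), by positivity, Real.sq_sqrt (by positivity)⟩
  obtain ⟨β, hβ, hβ2⟩ : ∃ β : ℝ, 0 < β ∧ β ^ 2 = 1 + b ^ 2 :=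
    ⟨√(1 + b ^ 2), by positivity, Real.sq_sqrt (by positivity)⟩
  have hαβ : (1 + a * b) ^ 2 < (α * β) ^ 2 := by
    rw [mul_pow, hα2, hβ2]
    nlinarith [mul_pos hba hba]
  obtain ⟨hC1, hC2⟩ := abs_lt.1 (abs_lt_of_sq_lt_sq hαβ (by positivity))
  obtain ⟨p, hp, hp2⟩ : ∃ p : ℝ, 0 < p ∧ p ^ 2 = 2 * (α * β + (1 + a * b)) :=
    ⟨√(2 * (α * β + (1 + a * b))), Real.sqrt_pos.2 (by linarith), Real.sq_sqrt (by linarith)⟩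
  obtain ⟨q, hq, hq2⟩ : ∃ q : ℝ, 0 < q ∧ q ^ 2 = 2 * (α * β - (1 + a * b)) :=
    ⟨√(2 * (α * β - (1 + a * b))), Real.sqrt_pos.2 (by linarith), Real.sq_sqrt (by linarith)⟩
  have hderiv : ∀ y ∈ Set.Ioo a b, HasDerivAt (fun y =>
      (α + β) / p * arctan ((β * (y - a) - α * (b - y)) / (p * √((y - a) * (b - y))))
      - arctan ((1 * (y - a) - 1 * (b - y)) / (2 * √((y - a) * (b - y))))
      + (β - α) / (2 * q) * (log (β * (y - a) + α * (b - y) - q * √((y - a) * (b - y)))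
        - log (β * (y - a) + α * (b - y) + q * √((y - a) * (b - y)))))
      (√((y - a) * (b - y)) / (y ^ 2 + 1)) y := by
    rintro y ⟨h1, h2⟩
    have hX := sub_pos.2 h1
    have hZ := sub_pos.2 h2
    have hXZ := mul_pos hX hZ
    have hw := Real.sqrt_pos.2 hXZ
    have hsq := Real.sq_sqrt hXZ.le
    have E1 : p ^ 2 * ((y - a) * (b - y)) + (β * (y - a) - α * (b - y)) ^ 2
        = (b - a) ^ 2 * (y ^ 2 + 1) := by
      rw [hp2]
      linear_combination (y - a) ^ 2 * hβ2 + (b - y) ^ 2 * hα2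
    have E2 : (β * (y - a) + α * (b - y)) ^ 2 - q ^ 2 * ((y - a) * (b - y))
        = (b - a) ^ 2 * (y ^ 2 + 1) := by
      rw [hq2]
      linear_combination (y - a) ^ 2 * hβ2 + (b - y) ^ 2 * hα2
    have E3 : (2:ℝ) ^ 2 * ((y - a) * (b - y)) + (1 * (y - a) - 1 * (b - y)) ^ 2
        = (b - a) ^ 2 := by ring
    have hpl : 0 < β * (y - a) + α * (b - y) + q * √((y - a) * (b - y)) := by positivity
    have hm : 0 < β * (y - a) + α * (b - y) - q * √((y - a) * (b - y)) := by
      have : 0 < (β * (y - a) + α * (b - y) - q * √((y - a) * (b - y))) *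
          (β * (y - a) + α * (b - y) + q * √((y - a) * (b - y))) := by
        have : (β * (y - a) + α * (b - y) - q * √((y - a) * (b - y))) *
          (β * (y - a) + α * (b - y) + q * √((y - a) * (b - y))) = (b - a) ^ 2 * (y ^ 2 + 1) := by
          rw [← E2]
          linear_combination - q ^ 2 * hsq
        rw [this]; positivity
      exact pos_of_mul_pos_left this hpl.le
    have d1 := (SWKB.arctan_deriv a b β α p y h1 h2 hp).const_mul ((α + β) / p)
    have d2 := SWKB.arctan_deriv a b 1 1 2 y h1 h2 two_pos
    have d3 := (SWKB.log_deriv a b β α q y h1 h2 hm hpl).const_mul ((β - α) / (2 * q))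
    rw [E1] at d1
    rw [E3] at d2
    rw [E2] at d3
    refine ((d1.sub d2).add d3).congr_deriv ?_
    symm
    set w := √((y - a) * (b - y))
    have hy : 0 < y ^ 2 + 1 := by positivity
    have F1 : (α + β) / p * (p * (b - a) * (β * (y - a) + α * (b - y)) /
        (2 * w * ((b - a) ^ 2 * (y ^ 2 + 1)))) =
        (α + β) * (β * (y - a) + α * (b - y)) / (2 * w * (b - a) * (y ^ 2 + 1)) := by
      field_simp
    have F2 : 2 * (b - a) * (1 * (y - a) + 1 * (b - y)) / (2 * w * (b - a) ^ 2) = 1 / w := by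
      field_simp; ring
    have F3 : (β - α) / (2 * q) * (q * (b - a) * (β * (y - a) - α * (b - y)) /
        (w * ((b - a) ^ 2 * (y ^ 2 + 1)))) =
        (β - α) * (β * (y - a) - α * (b - y)) / (2 * w * (b - a) * (y ^ 2 + 1)) := by
      field_simp
    rw [F1, F2, F3]
    field_simp
    rw [hsq]
    linear_combination (-2) * (y - a) * hβ2 + (-2) * (b - y) * hα2
  have hint : IntervalIntegrable (fun y => √((y - a) * (b - y)) / (y ^ 2 + 1)) volume a b := by
    apply Continuous.intervalIntegrable
    apply Continuous.div (by fun_prop) (by fun_prop)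
    intro y; positivity
  have key := intervalIntegral.integral_eq_sub_of_hasDerivAt_of_tendsto hab hderiv hint
    ((((SWKB.arctan_left a b β α p hab hα hp).const_mul ((α + β) / p)).sub
      (SWKB.arctan_left a b 1 1 2 hab one_pos two_pos)).add
      ((SWKB.log_tendsto a b β α q a (by simp) (by simp; exact ⟨hα.ne', hba.ne'⟩) _).const_mul
        ((β - α) / (2 * q))))
    ((((SWKB.arctan_right a b β α p hab hβ hp).const_mul ((α + β) / p)).sub
      (SWKB.arctan_right a b 1 1 2 hab one_pos two_pos)).add
      ((SWKB.log_tendsto a b β α q b (by simp) (by simp; exact ⟨hβ.ne', hba.ne'⟩) _).const_mul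
        ((β - α) / (2 * q))))
  rw [key]
  have hs : √((1 + a ^ 2) * (1 + b ^ 2)) = α * β := by
    rw [← hα2, ← hβ2, ← mul_pow]
    exact Real.sqrt_sq (by positivity)
  rw [hs]
  have hfin : √(α * β - a * b + 1) = √2 * ((α + β) / p) := by
    rw [Real.sqrt_eq_iff_mul_self_eq_of_pos (by positivity)]
    have h2 : √2 ^ 2 = (2:ℝ) := Real.sq_sqrt (by norm_num)
    have : √2 * ((α + β) / p) * (√2 * ((α + β) / p)) = √2 ^ 2 * (α + β) ^ 2 / p ^ 2 := by
      field_simp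
    rw [this, h2, div_eq_iff (by positivity), hp2]
    have : α ^ 2 * β ^ 2 = (1 + a ^ 2) * (1 + b ^ 2) := by rw [hα2, hβ2]
    linear_combination 2 * hα2 + 2 * hβ2 - 2 * this
  rw [hfin]
  have : √2 ≠ (0:ℝ) := by positivity
  field_simp
  ring
end

section
/- For all real numbers a, b with −1 < a < b < 1, ∫_{a}^{b} √((y − a)(b − y))/(1 − y²) dy = (π/2)·(2 − √((1 − a)(1 − b)) − √((1 + a)(1 + b))). -/
open Real MeasureTheory

lemma cont_aux (p q : ℝ) (hp : 0 < p) (hpq : p < q) :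
    ContinuousOn (fun t : ℝ => Real.sqrt ((t - p) * (q - t)) / t) (Set.Icc p q) := by
  apply ContinuousOn.div
  · fun_prop
  · fun_prop
  · intro t ht
    have := ht.1
    linarith

lemma int_aux (p q : ℝ) (hp : 0 < p) (hpq : p < q) :
    ∫ t in p..q, Real.sqrt ((t - p) * (q - t)) / t
      = Real.pi / 2 * (p + q - 2 * Real.sqrt (p * q)) := by
  have hq : 0 < q := hp.trans hpq
  have hd : 0 < q - p := by linarith
  set K := Real.sqrt (p * q) with hK
  have hKpos : 0 < K := Real.sqrt_pos.2 (mul_pos hp hq)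
  have hK2 : K ^ 2 = p * q := Real.sq_sqrt (mul_pos hp hq).le
  let F : ℝ → ℝ := fun t => Real.sqrt ((t - p) * (q - t))
    + (p + q) / 2 * Real.arcsin ((2 * t - p - q) / (q - p))
    - K * Real.arcsin (((p + q) * t - 2 * p * q) / (t * (q - p)))
  have key : ∫ t in p..q, Real.sqrt ((t - p) * (q - t)) / t = F q - F p := by
    apply intervalIntegral.integral_eq_sub_of_hasDerivAt_of_le hpq.le
    · have h1 : ContinuousOn (fun t : ℝ => ((p + q) * t - 2 * p * q) / (t * (q - p)))
          (Set.Icc p q) := by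
        apply ContinuousOn.div
        · fun_prop
        · fun_prop
        · intro t ht
          have : 0 < t := lt_of_lt_of_le hp ht.1
          positivity
      have h2 := Real.continuous_arcsin.comp_continuousOn h1
      have h3 : Continuous (fun t : ℝ => Real.arcsin ((2 * t - p - q) / (q - p))) :=
        Real.continuous_arcsin.comp (by fun_prop)
      have h4 : Continuous (fun t : ℝ => Real.sqrt ((t - p) * (q - t))) := by fun_prop
      exact (h4.continuousOn.add (continuousOn_const.mul h3.continuousOn)).sub
        (continuousOn_const.mul h2)
    · intro t ht
      obtain ⟨h1, h2⟩ := ht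
      have ht0 : 0 < t := hp.trans h1
      have hR : 0 < (t - p) * (q - t) := mul_pos (by linarith) (by linarith)
      set S := Real.sqrt ((t - p) * (q - t)) with hS
      have hSpos : 0 < S := Real.sqrt_pos.2 hR
      have hS2 : S ^ 2 = (t - p) * (q - t) := Real.sq_sqrt hR.le
      have hu : 1 - ((2 * t - p - q) / (q - p)) ^ 2 = (2 * S / (q - p)) ^ 2 := by
        rw [div_pow, div_pow, mul_pow, hS2]; field_simp; ring
      have hv : 1 - (((p + q) * t - 2 * p * q) / (t * (q - p))) ^ 2
          = (2 * K * S / (t * (q - p))) ^ 2 := by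
        rw [div_pow, div_pow, mul_pow (2 * K) S, mul_pow 2 K, hS2, hK2]; field_simp; ring
      have hu0 : 0 < 2 * S / (q - p) := by positivity
      have hv0 : 0 < 2 * K * S / (t * (q - p)) := by positivity
      have d1 : HasDerivAt (fun t : ℝ => Real.sqrt ((t - p) * (q - t)))
          ((1 * (q - t) + (t - p) * (-1)) / (2 * S)) t :=
        (((hasDerivAt_id t).sub_const p).mul ((hasDerivAt_id t).const_sub q)).sqrt hR.ne'
      have d2 : HasDerivAt (fun t : ℝ => (2 * t - p - q) / (q - p)) (2 / (q - p)) t := by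
        have := ((((hasDerivAt_id t).const_mul 2).sub_const p).sub_const q).div_const (q - p)
        simpa using this
      have d3 : HasDerivAt (fun t : ℝ => ((p + q) * t - 2 * p * q) / (t * (q - p)))
          (2 * p * q / (t ^ 2 * (q - p))) t := by
        have := (((hasDerivAt_id t).const_mul (p + q)).sub_const (2 * p * q)).div
          ((hasDerivAt_id t).mul_const (q - p)) (by simp only [id]; positivity)
        refine HasDerivAt.congr_deriv this ?_
        try simp only [id]
        field_simp
        ring
      have a2 := (Real.hasDerivAt_arcsin (x := (2 * t - p - q) / (q - p))
        (by intro h; rw [h] at hu; nlinarith [pow_pos hu0 2])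
        (by intro h; rw [h] at hu; nlinarith [pow_pos hu0 2])).comp t d2
      have a3 := (Real.hasDerivAt_arcsin (x := ((p + q) * t - 2 * p * q) / (t * (q - p)))
        (by intro h; rw [h] at hv; nlinarith [pow_pos hv0 2])
        (by intro h; rw [h] at hv; nlinarith [pow_pos hv0 2])).comp t d3
      rw [hu, Real.sqrt_sq hu0.le] at a2
      rw [hv, Real.sqrt_sq hv0.le] at a3
      have := (d1.add (a2.const_mul ((p + q) / 2))).sub (a3.const_mul K)
      refine HasDerivAt.congr_deriv this ?_
      have e : S / t = S ^ 2 / (t * S) := by field_simp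
      rw [e, hS2]
      field_simp
      ring
    · apply ContinuousOn.intervalIntegrable
      rw [Set.uIcc_of_le hpq.le]
      exact cont_aux p q hp hpq
  rw [key]
  have e1 : (2 * q - p - q) / (q - p) = 1 := by rw [div_eq_one_iff_eq hd.ne']; ring
  have e2 : (2 * p - p - q) / (q - p) = -1 := by field_simp; ring
  have e3 : ((p + q) * q - 2 * p * q) / (q * (q - p)) = 1 := by
    rw [div_eq_one_iff_eq (by positivity)]; ring
  have e4 : ((p + q) * p - 2 * p * q) / (p * (q - p)) = -1 := by field_simp; ring
  simp only [F, e1, e2, e3, e4, sub_self, mul_zero, zero_mul, Real.sqrt_zero, Real.arcsin_one,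
    Real.arcsin_neg_one]
  ring

/-- Closed-form integral formula used for SWKB integrals of conventional
shape-invariant potentials: for `-1 < a < b < 1`,
`∫_a^b √((y - a)(b - y))/(1 - y²) dy
  = (π/2) (2 - √((1 - a)(1 - b)) - √((1 + a)(1 + b)))`. -/
theorem integral_sqrt_div_one_sub_sq (a b : ℝ) (ha : -1 < a) (hab : a < b) (hb : b < 1) :
    ∫ y in a..b, Real.sqrt ((y - a) * (b - y)) / (1 - y ^ 2)
      = Real.pi / 2 *
          (2 - Real.sqrt ((1 - a) * (1 - b)) - Real.sqrt ((1 + a) * (1 + b))) := by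
  have A := int_aux (1 + a) (1 + b) (by linarith) (by linarith)
  have B := int_aux (1 - b) (1 - a) (by linarith) (by linarith)
  rw [← intervalIntegral.integral_comp_add_left
    (fun t => Real.sqrt ((t - (1 + a)) * (1 + b - t)) / t) 1] at A
  rw [← intervalIntegral.integral_comp_sub_left
    (fun t => Real.sqrt ((t - (1 - b)) * (1 - a - t)) / t) 1] at B
  have hA : ∀ y : ℝ, (1 + y - (1 + a)) * (1 + b - (1 + y)) = (y - a) * (b - y) := by
    intro y; ring
  have hB : ∀ y : ℝ, (1 - y - (1 - b)) * (1 - a - (1 - y)) = (y - a) * (b - y) := by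
    intro y; ring
  simp only [hA] at A
  simp only [hB] at B
  have iA : IntervalIntegrable (fun y => Real.sqrt ((y - a) * (b - y)) / (1 + y)) volume a b := by
    apply ContinuousOn.intervalIntegrable
    rw [Set.uIcc_of_le hab.le]
    refine ContinuousOn.div (by fun_prop) (by fun_prop) ?_
    intro y hy
    have := hy.1
    linarith
  have iB : IntervalIntegrable (fun y => Real.sqrt ((y - a) * (b - y)) / (1 - y)) volume a b := by
    apply ContinuousOn.intervalIntegrable
    rw [Set.uIcc_of_le hab.le]
    refine ContinuousOn.div (by fun_prop) (by fun_prop) ?_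
    intro y hy
    have := hy.2
    linarith
  have C : ∫ y in a..b, Real.sqrt ((y - a) * (b - y)) / (1 - y ^ 2)
      = ∫ y in a..b, (1 / 2 : ℝ) * (Real.sqrt ((y - a) * (b - y)) / (1 + y)
          + Real.sqrt ((y - a) * (b - y)) / (1 - y)) := by
    apply intervalIntegral.integral_congr
    intro y hy
    rw [Set.uIcc_of_le hab.le] at hy
    have h1 : 1 + y ≠ 0 := by have := hy.1; linarith
    have h2 : 1 - y ≠ 0 := by have := hy.2; linarith
    have h3 : 1 - y ^ 2 = (1 + y) * (1 - y) := by ring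
    simp only [h3]
    field_simp
    ring
  rw [C, intervalIntegral.integral_const_mul, intervalIntegral.integral_add iA iB, A, B,
    mul_comm (1 - b) (1 - a)]
  ring
end

section
/- Let ħ ≠ 0 be real, let I ⊆ ℝ be an open interval, let V : ℝ → ℝ, and let φ, ψ : ℝ → ℝ be twice differentiable on I with φ(x) ≠ 0 for all x ∈ I. Suppose −ħ²φ''(x) + V(x)φ(x) = Ẽ·φ(x) and −ħ²ψ''(x) + V(x)ψ(x) = E·ψ(x) for all x ∈ I, for real constants Ẽ and E. Define χ(x) = (φ(x)ψ'(x) − φ'(x)ψ(x))/φ(x). Then χ is twice differentiable on I and satisfies −ħ²χ''(x) + (V(x) − 2ħ²·(φ'/φ)'(x))χ(x) = E·χ(x) for all x ∈ I. -/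
open Real

/-- One-step Darboux transformation: if `φ` (with eigenvalue `Ẽ`) and `ψ` (with
eigenvalue `E`) solve the Schrödinger equation with potential `V` on an open
interval `(a, b)` on which `φ` never vanishes, then
`χ = (φ ψ' - φ' ψ)/φ` is twice differentiable there and solves the Schrödinger
equation with the transformed potential `V - 2ℏ² (φ'/φ)'` at eigenvalue `E`. -/
theorem darboux_transformation (ℏ : ℝ) (hℏ : ℏ ≠ 0) (a b : ℝ)
    (V φ ψ φ' φ'' ψ' ψ'' : ℝ → ℝ) (Et E : ℝ)
    (hφ1 : ∀ x ∈ Set.Ioo a b, HasDerivAt φ (φ' x) x)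
    (hφ2 : ∀ x ∈ Set.Ioo a b, HasDerivAt φ' (φ'' x) x)
    (hψ1 : ∀ x ∈ Set.Ioo a b, HasDerivAt ψ (ψ' x) x)
    (hψ2 : ∀ x ∈ Set.Ioo a b, HasDerivAt ψ' (ψ'' x) x)
    (hφ0 : ∀ x ∈ Set.Ioo a b, φ x ≠ 0)
    (heqφ : ∀ x ∈ Set.Ioo a b, -ℏ ^ 2 * φ'' x + V x * φ x = Et * φ x)
    (heqψ : ∀ x ∈ Set.Ioo a b, -ℏ ^ 2 * ψ'' x + V x * ψ x = E * ψ x) :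
    ∃ χ' χ'' : ℝ → ℝ,
      (∀ x ∈ Set.Ioo a b,
        HasDerivAt (fun y => (φ y * ψ' y - φ' y * ψ y) / φ y) (χ' x) x) ∧
      (∀ x ∈ Set.Ioo a b, HasDerivAt χ' (χ'' x) x) ∧
      (∀ x ∈ Set.Ioo a b,
        -ℏ ^ 2 * χ'' x
          + (V x - 2 * ℏ ^ 2 * deriv (fun y => φ' y / φ y) x)
              * ((φ x * ψ' x - φ' x * ψ x) / φ x)
          = E * ((φ x * ψ' x - φ' x * ψ x) / φ x)) := by
  have h2 : ℏ ^ 2 ≠ 0 := pow_ne_zero 2 hℏ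
  have eφ : ∀ x ∈ Set.Ioo a b, φ'' x = (V x - Et) * φ x / ℏ ^ 2 := by
    intro x hx
    rw [eq_div_iff h2]
    linarith [heqφ x hx]
  have eψ : ∀ x ∈ Set.Ioo a b, ψ'' x = (V x - E) * ψ x / ℏ ^ 2 := by
    intro x hx
    rw [eq_div_iff h2]
    linarith [heqψ x hx]
  have hW : ∀ x ∈ Set.Ioo a b, HasDerivAt (fun y => φ y * ψ' y - φ' y * ψ y)
      ((Et - E) / ℏ ^ 2 * (φ x * ψ x)) x := by
    intro x hx
    refine (((hφ1 x hx).fun_mul (hψ2 x hx)).fun_sub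
      ((hφ2 x hx).fun_mul (hψ1 x hx))).congr_deriv ?_
    rw [eφ x hx, eψ x hx]
    field_simp
    ring
  refine ⟨fun x => (Et - E) / ℏ ^ 2 * ψ x
      - (φ x * ψ' x - φ' x * ψ x) * φ' x / (φ x * φ x),
    fun x => (Et - E) / ℏ ^ 2 * ψ' x
      - ((((Et - E) / ℏ ^ 2 * (φ x * ψ x)) * φ' x
          + (φ x * ψ' x - φ' x * ψ x) * φ'' x) * (φ x * φ x)
        - (φ x * ψ' x - φ' x * ψ x) * φ' x * (φ' x * φ x + φ x * φ' x))
        / (φ x * φ x) ^ 2, ?_, ?_, ?_⟩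
  · intro x hx
    have h0 := hφ0 x hx
    refine ((hW x hx).fun_div (hφ1 x hx) h0).congr_deriv ?_
    field_simp
  · intro x hx
    have h0 := hφ0 x hx
    exact ((hψ1 x hx).const_mul _).fun_sub
      (((hW x hx).fun_mul (hφ2 x hx)).fun_div
        ((hφ1 x hx).fun_mul (hφ1 x hx)) (mul_ne_zero h0 h0))
  · intro x hx
    have h0 := hφ0 x hx
    have hd : deriv (fun y => φ' y / φ y) x = _ :=
      ((hφ2 x hx).fun_div (hφ1 x hx) h0).deriv
    rw [hd]
    simp only [eφ x hx]
    field_simp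
    ring
end
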